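/- arXiv:1508.06912 — 3 statements merged into one kernel-verified Lean document; each statement's English description precedes it below -/
import Mathlib

section
/- For m ≥ 1 and n > γm, the central moments μ_{n,m,γ}(x) = B_{n,γ}^{α,β}((t−x)^m, x) satisfy the recurrence (n − γm)(n+β)·μ_{n,m+1,γ}(x) = n·x(1+γx)·(μ'_{n,m,γ}(x) + m·μ_{n,m−1,γ}(x)) + (mn + n²x − (2γm − n)(α − (n+β)x))·μ_{n,m,γ}(x) + (mγ(n+β)·(α/(n+β) − x)² − mn·(α/(n+β) − x))·μ_{n,m−1,γ}(x). -/
open MeasureTheory Filter Real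

noncomputable def p (n γ : ℝ) (k : ℕ) (x : ℝ) : ℝ :=
  Real.Gamma (n / γ + (k : ℝ)) / (Real.Gamma ((k : ℝ) + 1) * Real.Gamma (n / γ)) *
    (γ * x) ^ k / (1 + γ * x) ^ (n / γ + (k : ℝ))

noncomputable def b (n γ : ℝ) (k : ℕ) (t : ℝ) : ℝ :=
  γ * Real.Gamma (n / γ + (k : ℝ) + 1) / (Real.Gamma (k : ℝ) * Real.Gamma (n / γ + 1)) *
    (γ * t) ^ (k - 1) / (1 + γ * t) ^ (n / γ + (k : ℝ) + 1)

noncomputable def B (n γ α β : ℝ) (f : ℝ → ℝ) (x : ℝ) : ℝ :=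
  (∑' k : ℕ, p n γ (k + 1) x *
      ∫ t in Set.Ioi (0 : ℝ), b n γ (k + 1) t * f ((n * t + α) / (n + β))) +
    p n γ 0 x * f (α / (n + β))

noncomputable def μBDS (n : ℝ) (m : ℕ) (γ α β x : ℝ) : ℝ :=
  B n γ α β (fun t => (t - x) ^ m) x


theorem bds_tendsto_aux (q : ℝ) (hq : 0 < q) :
    Tendsto (fun t : ℝ => (1 + t) ^ (-q)) atTop (nhds 0) :=
  (tendsto_rpow_neg_atTop hq).comp (tendsto_atTop_add_const_left _ 1 tendsto_id)

theorem bds_beta (p : ℕ) : ∀ r : ℝ, (p : ℝ) + 1 < r →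
    IntegrableOn (fun t : ℝ => t ^ p * (1 + t) ^ (-r)) (Set.Ioi 0) ∧
    ∫ t in Set.Ioi (0 : ℝ), t ^ p * (1 + t) ^ (-r) =
      (p.factorial : ℝ) * Real.Gamma (r - 1 - p) / Real.Gamma r := by
  induction p with
  | zero =>
    intro r hr
    simp only [Nat.cast_zero, zero_add] at hr
    have hint : IntegrableOn (fun t : ℝ => t ^ 0 * (1 + t) ^ (-r)) (Set.Ioi 0) := by
      have := integrableOn_add_rpow_Ioi_of_lt (a := -r) (c := 0) (m := 1) (by linarith) (by norm_num)
      simpa [add_comm] using this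
    refine ⟨hint, ?_⟩
    have h := integral_Ioi_of_hasDerivAt_of_tendsto' (a := (0 : ℝ)) (m := 0)
      (f := fun t : ℝ => (1 + t) ^ (-(r - 1)) * (-1 / (r - 1)))
      (f' := fun t : ℝ => t ^ 0 * (1 + t) ^ (-r)) ?_ hint ?_
    · rw [h]
      have hG : Real.Gamma r = (r - 1) * Real.Gamma (r - 1) := by
        have := Real.Gamma_add_one (s := r - 1) (by linarith)
        simpa using this
      have h1 : Real.Gamma (r - 1) ≠ 0 := (Real.Gamma_pos_of_pos (by linarith)).ne'
      have h2 : r - 1 ≠ 0 := by linarith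
      rw [hG]
      simp
      field_simp
    · intro t ht
      have ht' : (0 : ℝ) < 1 + t := by have : (0:ℝ) ≤ t := ht; linarith
      have h1 : HasDerivAt (fun t : ℝ => 1 + t) 1 t := (hasDerivAt_id t).const_add 1
      have h2 := (h1.rpow_const (p := -(r - 1)) (Or.inl ht'.ne')).mul_const (-1 / (r - 1))
      refine h2.congr_deriv ?_
      have h2 : r - 1 ≠ 0 := by linarith
      rw [show -(r - 1) - 1 = -r by ring]
      field_simp
    · simpa using (bds_tendsto_aux (r - 1) (by linarith)).mul_const (-1 / (r - 1))
  | succ p ih =>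
    intro r hr
    push_cast at hr
    obtain ⟨i1, v1⟩ := ih (r - 1) (by linarith)
    have key : ∀ t : ℝ, 0 < 1 + t → (1 + t) ^ (-(r - 1)) = (1 + t) * (1 + t) ^ (-r) := by
      intro t ht
      rw [show -(r - 1) = -r + 1 by ring, Real.rpow_add_one ht.ne']
      ring
    have i2 : IntegrableOn (fun t : ℝ => t ^ (p + 1) * (1 + t) ^ (-r)) (Set.Ioi 0) := by
      refine Integrable.mono' i1 ?_ ?_
      · refine ContinuousOn.aestronglyMeasurable ?_ measurableSet_Ioi
        refine ContinuousOn.mul (by fun_prop) (ContinuousOn.rpow_const (by fun_prop) ?_)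
        intro t ht
        have : (0:ℝ) < t := ht
        left; linarith
      · refine (ae_restrict_iff' measurableSet_Ioi).2 (Eventually.of_forall ?_)
        intro t ht
        have ht : (0:ℝ) < t := ht
        have h1 : (0 : ℝ) < 1 + t := by linarith
        have h3 : 0 ≤ (1 + t) ^ (-r) := Real.rpow_nonneg h1.le _
        rw [Real.norm_of_nonneg (by positivity), key t h1, pow_succ, mul_assoc]
        gcongr
        linarith
    refine ⟨i2, ?_⟩
    have h := integral_Ioi_of_hasDerivAt_of_tendsto' (a := (0 : ℝ)) (m := 0)
      (f := fun t : ℝ => t ^ (p + 1) * (1 + t) ^ (-(r - 1)))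
      (f' := fun t : ℝ => ((p : ℝ) + 1) * (t ^ p * (1 + t) ^ (-(r - 1))) -
        (r - 1) * (t ^ (p + 1) * (1 + t) ^ (-r))) ?_
        ((i1.const_mul _).sub (i2.const_mul _)) ?_
    · rw [integral_sub (i1.const_mul _) (i2.const_mul _), integral_const_mul, integral_const_mul,
        v1] at h
      have hG : Real.Gamma r = (r - 1) * Real.Gamma (r - 1) := by
        have := Real.Gamma_add_one (s := r - 1) (by linarith)
        simpa using this
      have h1 : Real.Gamma (r - 1) ≠ 0 := (Real.Gamma_pos_of_pos (by linarith)).ne'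
      have h2 : r - 1 ≠ 0 := by linarith
      rw [hG, Nat.factorial_succ]
      push_cast
      rw [show r - 1 - ((p : ℝ) + 1) = r - 1 - 1 - p by ring]
      simp only [ne_eq, Nat.succ_ne_zero, not_false_eq_true, zero_pow, zero_mul, sub_zero] at h
      field_simp
      field_simp at h
      linarith
    · intro t ht
      have ht' : (0 : ℝ) < 1 + t := by have : (0:ℝ) ≤ t := ht; linarith
      have h1 : HasDerivAt (fun t : ℝ => 1 + t) 1 t := (hasDerivAt_id t).const_add 1
      have h2 := (hasDerivAt_pow (p + 1) t).mul
        (h1.rpow_const (p := -(r - 1)) (Or.inl ht'.ne'))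
      refine h2.congr_deriv ?_
      rw [show -(r - 1) - 1 = -r by ring]
      push_cast
      simp
      ring
    · refine squeeze_zero' (g := fun t : ℝ => (1 + t) ^ (-(r - (p + 2)))) ?_ ?_
        (bds_tendsto_aux _ (by linarith))
      · filter_upwards [eventually_ge_atTop 0] with t ht
        positivity
      · filter_upwards [eventually_ge_atTop 0] with t ht
        have h1 : (0 : ℝ) < 1 + t := by linarith
        have : (1 + t) ^ (-(r - ((p : ℝ) + 2))) = (1 + t) ^ (p + 1) * (1 + t) ^ (-(r - 1)) := by
          rw [← Real.rpow_natCast, ← Real.rpow_add h1]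
          congr 1
          push_cast
          ring
        rw [this]
        gcongr
        linarith

/-- coefficients -/
noncomputable def bdsW (n γ β : ℝ) (j : ℕ) : ℝ :=
  (n / (n + β)) ^ j * (Real.Gamma (n / γ + 1 - j) / (γ ^ j * Real.Gamma (n / γ + 1)))

theorem bdsW_succ (n γ β : ℝ) (hγ : 0 < γ) (j : ℕ) (hj : γ * j < n) :
    (n - γ * j) * bdsW n γ β (j + 1) = n / (n + β) * bdsW n γ β j := by
  unfold bdsW
  have h0 : 0 < n / γ - j := by
    rw [sub_pos, lt_div_iff₀ hγ]; linarith
  have h1 : Real.Gamma (n / γ + 1 - j) = (n / γ - j) * Real.Gamma (n / γ - j) := by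
    rw [← Real.Gamma_add_one h0.ne']; congr 1; ring
  have h2 : n - γ * j = γ * (n / γ - j) := by field_simp
  rw [h1, h2]
  push_cast
  rw [show n / γ + 1 - ((j : ℝ) + 1) = n / γ - j by ring, pow_succ, pow_succ]
  generalize n / γ - (j : ℝ) = u at *
  generalize Real.Gamma u = v
  generalize n / (n + β) = a
  field_simp

theorem bds_int (n γ : ℝ) (hγ : 0 < γ) (hn : 0 < n) (k j : ℕ) (hj : γ * j < n + γ) :
    IntegrableOn (fun t : ℝ => b n γ (k + 1) t * t ^ j) (Set.Ioi 0) ∧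
    ∫ t in Set.Ioi (0 : ℝ), b n γ (k + 1) t * t ^ j =
      Real.Gamma (n / γ + 1 - j) / (γ ^ j * Real.Gamma (n / γ + 1)) *
        ((k + 1).ascFactorial j : ℝ) := by
  have hs : 0 < n / γ := by positivity
  have h0 : 0 < n / γ + 1 - j := by
    have : (j : ℝ) < (n + γ) / γ := by rw [lt_div_iff₀ hγ]; linarith
    rw [add_div, div_self hγ.ne'] at this
    linarith
  obtain ⟨hi, hv⟩ := bds_beta (k + j) (n / γ + k + 2) (by push_cast; linarith)
  set f : ℝ → ℝ := fun t : ℝ => t ^ (k + j) * (1 + t) ^ (-(n / γ + k + 2)) with hf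
  set C : ℝ := γ * Real.Gamma (n / γ + k + 2) / (k.factorial * Real.Gamma (n / γ + 1)) / γ ^ j with hC
  have hb : Set.EqOn (fun t => C * f (γ * t)) (fun t : ℝ => b n γ (k + 1) t * t ^ j) (Set.Ioi 0) := by
    intro t ht
    have ht : (0:ℝ) < t := ht
    have h1 : 0 < 1 + γ * t := by positivity
    simp only [hC, hf, b, Nat.add_sub_cancel]
    rw [Real.rpow_neg h1.le]
    push_cast
    rw [Real.Gamma_nat_eq_factorial, show n / γ + ((k : ℝ) + 1) + 1 = n / γ + k + 2 by ring, pow_add, mul_pow γ t j]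
    field_simp
  constructor
  · refine IntegrableOn.congr_fun ?_ hb measurableSet_Ioi
    refine Integrable.const_mul ?_ C
    have := (integrableOn_Ioi_comp_mul_left_iff f 0 hγ).2 (by simpa using hi)
    exact this
  · rw [← setIntegral_congr_fun measurableSet_Ioi hb, integral_const_mul,
      integral_comp_mul_left_Ioi f 0 hγ, mul_zero, hv]
    have hfac : ((k + j).factorial : ℝ) = k.factorial * ((k + 1).ascFactorial j : ℝ) := by
      rw [← Nat.factorial_mul_ascFactorial]; push_cast; ring
    have g1 : Real.Gamma (n / γ + k + 2) ≠ 0 := (Real.Gamma_pos_of_pos (by positivity)).ne'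
    have g2 : Real.Gamma (n / γ + 1) ≠ 0 := (Real.Gamma_pos_of_pos (by positivity)).ne'
    have g3 : (k.factorial : ℝ) ≠ 0 := by positivity
    rw [hfac, show n / γ + k + 2 - 1 - ((k + j : ℕ) : ℝ) = n / γ + 1 - j by push_cast; ring]
    simp only [hC, smul_eq_mul]
    field_simp

theorem bds_int_pow (n γ α β y : ℝ) (hγ : 0 < γ) (hn : 0 < n) (k m : ℕ) (hm : γ * m < n + γ) :
    ∫ t in Set.Ioi (0 : ℝ), b n γ (k + 1) t * ((n * t + α) / (n + β) - y) ^ m =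
      ∑ j ∈ Finset.range (m + 1), (α / (n + β) - y) ^ (m - j) * (m.choose j : ℝ) *
        (bdsW n γ β j * ((k + 1).ascFactorial j : ℝ)) := by
  have hj : ∀ j ∈ Finset.range (m + 1), γ * (j : ℝ) < n + γ := by
    intro j hj
    have : (j : ℝ) ≤ m := by exact_mod_cast Nat.lt_succ_iff.1 (Finset.mem_range.1 hj)
    nlinarith
  have : ∀ t : ℝ, b n γ (k + 1) t * ((n * t + α) / (n + β) - y) ^ m =
      ∑ j ∈ Finset.range (m + 1), ((α / (n + β) - y) ^ (m - j) * (m.choose j : ℝ) *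
        (n / (n + β)) ^ j) * (b n γ (k + 1) t * t ^ j) := by
    intro t
    rw [show (n * t + α) / (n + β) - y = n / (n + β) * t + (α / (n + β) - y) by ring, add_pow,
      Finset.mul_sum]
    refine Finset.sum_congr rfl fun j _ => ?_
    rw [mul_pow]; ring
  simp_rw [this]
  rw [integral_finsetSum _ fun j h => ((bds_int n γ hγ hn k j (hj j h)).1.const_mul _)]
  refine Finset.sum_congr rfl fun j h => ?_
  rw [integral_const_mul, (bds_int n γ hγ hn k j (hj j h)).2, bdsW]
  ring

noncomputable def bdsA (n γ : ℝ) (k : ℕ) : ℝ :=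
  Real.Gamma (n / γ + (k : ℝ)) / (Real.Gamma ((k : ℝ) + 1) * Real.Gamma (n / γ))

theorem bdsA_pos (n γ : ℝ) (hγ : 0 < γ) (hn : 0 < n) (k : ℕ) : 0 < bdsA n γ k := by
  have hs : 0 < n / γ := by positivity
  unfold bdsA
  have h1 := Real.Gamma_pos_of_pos (s := n / γ + k) (by positivity)
  have h2 := Real.Gamma_pos_of_pos (s := (k : ℝ) + 1) (by positivity)
  have h3 := Real.Gamma_pos_of_pos hs
  positivity

theorem bdsA_succ (n γ : ℝ) (hγ : 0 < γ) (hn : 0 < n) (k : ℕ) :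
    bdsA n γ (k + 1) = (n / γ + k) / (1 + k) * bdsA n γ k := by
  have hs : 0 < n / γ := by positivity
  unfold bdsA
  have h1 := Real.Gamma_add_one (s := n / γ + k) (by positivity)
  have h2 := Real.Gamma_add_one (s := (k : ℝ) + 1) (by positivity)
  have h3 := Real.Gamma_pos_of_pos (s := (k : ℝ) + 1) (by positivity)
  push_cast
  rw [← add_assoc, h1, h2]
  field_simp
  ring

theorem bds_asc_succ (k j : ℕ) (hk : k ≠ 0) :
    ((k + 1).ascFactorial j : ℝ) = (j + 1 * k) / (0 + 1 * k) * (k.ascFactorial j : ℝ) := by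
  have := Nat.succ_ascFactorial k j
  have h : (k : ℝ) * ((k + 1).ascFactorial j : ℝ) = (k + j) * (k.ascFactorial j : ℝ) := by
    exact_mod_cast this
  have hk' : (k : ℝ) ≠ 0 := by exact_mod_cast hk
  field_simp
  linarith

theorem bds_summable (n γ : ℝ) (hγ : 0 < γ) (hn : 0 < n) (j : ℕ) (z : ℝ) (h0 : 0 ≤ z) (h1 : z < 1) :
    Summable fun k : ℕ => bdsA n γ k * (k.ascFactorial j : ℝ) * z ^ k := by
  rcases h0.eq_or_lt with rfl | h0
  · refine summable_of_ne_finset_zero (s := {0}) ?_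
    intro k hk
    simp at hk
    simp [hk]
  have pos : ∀ k : ℕ, k ≠ 0 → 0 < bdsA n γ k * (k.ascFactorial j : ℝ) * z ^ k := by
    intro k hk
    have := bdsA_pos n γ hγ hn k
    have h2 : 0 < k.ascFactorial j := by
      obtain ⟨k, rfl⟩ := Nat.exists_eq_succ_of_ne_zero hk
      exact Nat.ascFactorial_pos _ _
    have h3 : (0 : ℝ) < k.ascFactorial j := by exact_mod_cast h2
    positivity
  refine summable_of_ratio_test_tendsto_lt_one h1 ?_ ?_
  · filter_upwards [eventually_ne_atTop 0] with k hk
    exact (pos k hk).ne'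
  · have l1 := tendsto_add_mul_div_add_mul_atTop_nhds (n / γ) 1 (1 : ℝ) (d := 1) one_ne_zero
    have l2 := tendsto_add_mul_div_add_mul_atTop_nhds (j : ℝ) 0 (1 : ℝ) (d := 1) one_ne_zero
    have l := (l1.mul l2).mul_const z
    simp only [div_one, one_mul] at l
    refine l.congr' ?_
    filter_upwards [eventually_ne_atTop 0] with k hk
    have hp := pos k hk
    rw [Real.norm_of_nonneg (pos (k + 1) (by omega)).le, Real.norm_of_nonneg hp.le,
      eq_div_iff hp.ne', bdsA_succ n γ hγ hn, bds_asc_succ k j hk, pow_succ]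
    ring

noncomputable def bdsG (n γ : ℝ) (j : ℕ) (z : ℝ) : ℝ :=
  ∑' k : ℕ, bdsA n γ k * (k.ascFactorial j : ℝ) * z ^ k

theorem bds_asc_mul (k j : ℕ) :
    (k : ℝ) * (k.ascFactorial j : ℝ) = (k.ascFactorial (j + 1) : ℝ) - j * (k.ascFactorial j : ℝ) := by
  rw [Nat.ascFactorial_succ]; push_cast; ring

theorem bdsG_deriv (n γ : ℝ) (hγ : 0 < γ) (hn : 0 < n) (j : ℕ) (z : ℝ) (h0 : 0 < z) (h1 : z < 1) :
    HasDerivAt (bdsG n γ j) ((bdsG n γ (j + 1) z - j * bdsG n γ j z) / z) z := by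
  obtain ⟨r, hr1, hr2⟩ := exists_between h1
  have hr0 : 0 < r := h0.trans hr1
  have hid : ∀ w : ℝ, w ≠ 0 → ∀ k : ℕ, bdsA n γ k * (k.ascFactorial j : ℝ) * (k * w ^ (k - 1)) =
      (bdsA n γ k * (k.ascFactorial (j + 1) : ℝ) * w ^ k -
        j * (bdsA n γ k * (k.ascFactorial j : ℝ) * w ^ k)) / w := by
    intro w hw k
    have : (k : ℝ) * w ^ (k - 1) = k * w ^ k / w := by
      rcases k with _ | k
      · simp
      · rw [Nat.add_sub_cancel, pow_succ]; field_simp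
    rw [this]
    have h2 := bds_asc_mul k j
    rw [eq_div_iff hw]
    field_simp
    linear_combination (bdsA n γ k) * h2
  have hsum : Summable fun k : ℕ => bdsA n γ k * (k.ascFactorial j : ℝ) * (k * r ^ (k - 1)) := by
    simp_rw [hid r hr0.ne']
    exact ((bds_summable n γ hγ hn (j + 1) r hr0.le hr2).sub
      ((bds_summable n γ hγ hn j r hr0.le hr2).mul_left _)).div_const _
  have key := hasDerivAt_tsum_of_isPreconnected (t := Set.Ioo 0 r) (y₀ := z) (y := z)
    (g := fun (k : ℕ) (w : ℝ) => bdsA n γ k * (k.ascFactorial j : ℝ) * w ^ k)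
    (g' := fun (k : ℕ) (w : ℝ) => bdsA n γ k * (k.ascFactorial j : ℝ) * (k * w ^ (k - 1)))
    hsum isOpen_Ioo isPreconnected_Ioo
    (fun k w _ => (hasDerivAt_pow k w).const_mul _) ?_ ⟨h0, hr1⟩
    (bds_summable n γ hγ hn j z h0.le h1) ⟨h0, hr1⟩
  · simp_rw [hid z h0.ne'] at key
    rw [tsum_div_const, ((bds_summable n γ hγ hn (j + 1) z h0.le h1)).tsum_sub
      ((bds_summable n γ hγ hn j z h0.le h1).mul_left _), tsum_mul_left] at key
    exact key
  · intro k w hw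
    have hA := bdsA_pos n γ hγ hn k
    have hw0 : 0 < w := hw.1
    rw [Real.norm_of_nonneg (by positivity)]
    have := hw.2.le
    gcongr

noncomputable def bdsS (n γ : ℝ) (j : ℕ) (y : ℝ) : ℝ :=
  bdsG n γ j (γ * y / (1 + γ * y)) * (1 + γ * y) ^ (-(n / γ))

theorem bdsS_deriv (n γ : ℝ) (hγ : 0 < γ) (hn : 0 < n) (j : ℕ) (x : ℝ) (hx : 0 < x) :
    HasDerivAt (bdsS n γ j)
      ((bdsS n γ (j + 1) x - (j + n * x) * bdsS n γ j x) / (x * (1 + γ * x))) x := by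
  have hp : 0 < 1 + γ * x := by positivity
  have hz : HasDerivAt (fun y : ℝ => γ * y) γ x := by
    simpa using (hasDerivAt_id x).const_mul γ
  have hz1 : HasDerivAt (fun y : ℝ => 1 + γ * y) γ x := hz.const_add 1
  have hzz := hz.div hz1 hp.ne'
  have hG := bdsG_deriv n γ hγ hn j (γ * x / (1 + γ * x)) (by positivity)
    (by rw [div_lt_one hp]; linarith)
  have h := (HasDerivAt.comp x hG hzz).mul
    (hz1.rpow_const (p := -(n / γ)) (Or.inl hp.ne'))
  refine h.congr_deriv ?_
  simp only [bdsS, Function.comp]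
  rw [Real.rpow_sub_one hp.ne']
  simp only [Pi.div_apply]
  generalize bdsG n γ (j + 1) (γ * x / (1 + γ * x)) = g1
  generalize bdsG n γ j (γ * x / (1 + γ * x)) = g0
  generalize (1 + γ * x) ^ (-(n / γ)) = w
  field_simp
  ring

theorem bds_p_eq (n γ : ℝ) (hγ : 0 < γ) (k : ℕ) (y : ℝ) (hy : 0 ≤ y) :
    p n γ k y = bdsA n γ k * (γ * y / (1 + γ * y)) ^ k * (1 + γ * y) ^ (-(n / γ)) := by
  have hp : 0 < 1 + γ * y := by positivity
  unfold p bdsA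
  rw [Real.rpow_add hp, Real.rpow_natCast, Real.rpow_neg hp.le, div_pow]
  field_simp

theorem bds_hasSum (n γ : ℝ) (hγ : 0 < γ) (hn : 0 < n) (j : ℕ) (y : ℝ) (hy : 0 ≤ y) :
    HasSum (fun k : ℕ => p n γ k y * (k.ascFactorial j : ℝ)) (bdsS n γ j y) := by
  have hp : 0 < 1 + γ * y := by positivity
  have h := ((bds_summable n γ hγ hn j (γ * y / (1 + γ * y)) (by positivity)
    (by rw [div_lt_one hp]; linarith)).hasSum).mul_right ((1 + γ * y) ^ (-(n / γ)))
  refine Eq.subst (motive := fun f => HasSum f (bdsS n γ j y)) ?_ h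
  funext k
  rw [bds_p_eq n γ hγ k y hy]
  ring

theorem bds_mu_eq (n γ α β : ℝ) (hγ : 0 < γ) (hn : 0 < n) (m : ℕ) (hm : γ * m < n + γ)
    (y : ℝ) (hy : 0 ≤ y) :
    μBDS n m γ α β y = ∑ j ∈ Finset.range (m + 1), (α / (n + β) - y) ^ (m - j) * (m.choose j : ℝ) *
        (bdsW n γ β j * bdsS n γ j y) := by
  have hs : HasSum (fun k : ℕ => p n γ k y * ∑ j ∈ Finset.range (m + 1),
      (α / (n + β) - y) ^ (m - j) * (m.choose j : ℝ) * (bdsW n γ β j * (k.ascFactorial j : ℝ)))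
      (∑ j ∈ Finset.range (m + 1), (α / (n + β) - y) ^ (m - j) * (m.choose j : ℝ) *
        (bdsW n γ β j * bdsS n γ j y)) := by
    have : HasSum (fun k : ℕ => ∑ j ∈ Finset.range (m + 1), ((α / (n + β) - y) ^ (m - j) *
        (m.choose j : ℝ) * bdsW n γ β j) * (p n γ k y * (k.ascFactorial j : ℝ)))
      (∑ j ∈ Finset.range (m + 1), ((α / (n + β) - y) ^ (m - j) * (m.choose j : ℝ) *
        bdsW n γ β j) * bdsS n γ j y) :=
      hasSum_sum fun j _ => (bds_hasSum n γ hγ hn j y hy).mul_left _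
    convert this using 1
    · funext k
      rw [Finset.mul_sum]
      exact Finset.sum_congr rfl fun j _ => by ring
    · exact Finset.sum_congr rfl fun j _ => by ring
  rw [← hs.tsum_eq, hs.summable.tsum_eq_zero_add, add_comm]
  unfold μBDS B
  congr 1
  · exact tsum_congr fun k => by rw [bds_int_pow n γ α β y hγ hn k m hm]
  · congr 1
    have hG : Real.Gamma (n / γ + 1) ≠ 0 := (Real.Gamma_pos_of_pos (by positivity)).ne'
    rw [Finset.sum_range_succ', Finset.sum_eq_zero]
    · simp [bdsW, hG]
    · intro j _
      rw [Nat.zero_ascFactorial]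
      simp

open Polynomial in
noncomputable def bdsV (R : ℕ → ℝ) : ℝ[X] →ₗ[ℝ] ℝ :=
  Polynomial.lsum (fun j => (R j) • LinearMap.id)

open Polynomial in
theorem bdsV_monomial (R : ℕ → ℝ) (j : ℕ) (r : ℝ) : bdsV R (monomial j r) = R j * r := by
  simp [bdsV, Polynomial.lsum, Polynomial.sum_monomial_index]

open Polynomial in
theorem bdsV_eq (R : ℕ → ℝ) (c : ℝ) (m N : ℕ) (h : m < N) :
    bdsV R ((X + C c) ^ m) =
      ∑ j ∈ Finset.range N, c ^ (m - j) * (m.choose j : ℝ) * R j := by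
  rw [Polynomial.as_sum_range' ((X + C c) ^ m) N (by simpa using h), map_sum]
  refine Finset.sum_congr rfl fun j _ => ?_
  rw [bdsV_monomial, coeff_X_add_C_pow]
  ring

theorem bds_mu_V (n γ α β : ℝ) (hγ : 0 < γ) (hn : 0 < n) (m : ℕ) (hm : γ * m < n + γ)
    (y : ℝ) (hy : 0 ≤ y) :
    μBDS n m γ α β y = bdsV (fun j => bdsW n γ β j * bdsS n γ j y)
      ((Polynomial.X + Polynomial.C (α / (n + β) - y)) ^ m) := by
  rw [bds_mu_eq n γ α β hγ hn m hm y hy, bdsV_eq _ _ m (m + 1) (Nat.lt_succ_self m)]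

open Polynomial in
theorem bds_shift (n γ a x : ℝ) (R T : ℕ → ℝ) (m : ℕ)
    (h : ∀ j ≤ m, a * T j = (n - γ * j) * R (j + 1) - a * (j + n * x) * R j)
    (q : ℝ[X]) (hq : q.natDegree < m + 1) :
    a * bdsV T q = bdsV R (C n * X * q - C γ * X ^ 2 * derivative q - C a * X * derivative q
      - C (a * n * x) * q) := by
  rw [Polynomial.as_sum_range' q _ hq]
  simp only [map_sum, Finset.mul_sum, ← Finset.sum_sub_distrib]
  refine Finset.sum_congr rfl fun j hj => ?_
  have hj := h j (by simpa [Nat.lt_succ_iff] using hj)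
  generalize q.coeff j = r
  have e : C n * X * monomial j r - C γ * X ^ 2 * derivative (monomial j r)
      - C a * X * derivative (monomial j r) - C (a * n * x) * monomial j r
      = monomial (j + 1) ((n - γ * j) * r) - monomial j (a * (j + n * x) * r) := by
    simp only [← C_mul_X_pow_eq_monomial, derivative_C_mul_X_pow]
    rcases j with _ | j
    · simp; ring
    · simp only [Nat.add_sub_cancel, map_mul, map_sub, map_add]
      ring
  rw [e, map_sub, bdsV_monomial, bdsV_monomial, bdsV_monomial]
  linear_combination r * hj

theorem bds_mu_deriv (n γ α β : ℝ) (hγ : 0 < γ) (m : ℕ) (hn : 0 < n)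
    (hm : γ * ((m + 1 : ℕ) : ℝ) < n) (x : ℝ) (hx : 0 < x) :
    deriv (fun y => μBDS n (m + 1) γ α β y) x = - (m + 1) * μBDS n m γ α β x +
      bdsV (fun j => bdsW n γ β j *
        ((bdsS n γ (j + 1) x - (j + n * x) * bdsS n γ j x) / (x * (1 + γ * x))))
      ((Polynomial.X + Polynomial.C (α / (n + β) - x)) ^ (m + 1)) := by
  apply HasDerivAt.deriv
  have hev : (fun y => μBDS n (m + 1) γ α β y) =ᶠ[nhds x] fun y =>
      ∑ j ∈ Finset.range (m + 2), (α / (n + β) - y) ^ (m + 1 - j) * ((m + 1).choose j : ℝ) *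
        (bdsW n γ β j * bdsS n γ j y) := by
    filter_upwards [lt_mem_nhds hx] with y hy
    exact bds_mu_eq n γ α β hγ hn (m + 1) (by linarith) y (le_of_lt hy)
  refine HasDerivAt.congr_of_eventuallyEq ?_ hev
  have hm' : γ * (m : ℝ) < n + γ := by push_cast at hm; linarith
  rw [bds_mu_V n γ α β hγ hn m hm' x hx.le, bdsV_eq _ _ m (m + 2) (by omega),
    bdsV_eq _ _ (m + 1) (m + 2) (by omega), Finset.mul_sum, ← Finset.sum_add_distrib]
  refine HasDerivAt.fun_sum fun j hj => ?_
  have hj : j ≤ m + 1 := by simpa [Nat.lt_succ_iff] using hj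
  have hc : HasDerivAt (fun y : ℝ => α / (n + β) - y) (-1) x := by
    simpa using (hasDerivAt_id x).const_sub (α / (n + β))
  have h := ((hc.pow (m + 1 - j)).mul_const ((m + 1).choose j : ℝ)).mul
    ((bdsS_deriv n γ hγ hn j x hx).const_mul (bdsW n γ β j))
  refine h.congr_deriv ?_
  have hch : ((m + 1 - j : ℕ) : ℝ) * ((m + 1).choose j : ℝ) = (m + 1) * (m.choose j : ℝ) := by
    have := Nat.choose_mul_succ_eq m j
    rw [mul_comm] at this
    have h2 : ((m + 1) * m.choose j : ℝ) = ((m + 1).choose j : ℝ) * ((m + 1 - j : ℕ) : ℝ) := by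
      exact_mod_cast this
    linarith
  rw [show m + 1 - j - 1 = m - j by omega]
  simp only [Pi.pow_apply]
  linear_combination (-(α / (n + β) - x) ^ (m - j) * (bdsW n γ β j * bdsS n γ j x)) * hch

theorem BDS_central_moment_recurrence (n γ α β : ℝ) (m : ℕ)
    (hγ : 0 < γ) (hα : 0 ≤ α) (hαβ : α ≤ β) (hm : 1 ≤ m) (hn : γ * m < n) :
    ∀ x : ℝ, 0 ≤ x →
      (n - γ * m) * (n + β) * μBDS n (m + 1) γ α β x =
        n * x * (1 + γ * x) *
            (deriv (fun y => μBDS n m γ α β y) x + m * μBDS n (m - 1) γ α β x) +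
          (m * n + n ^ 2 * x - (2 * γ * m - n) * (α - (n + β) * x)) * μBDS n m γ α β x +
          (m * γ * (n + β) * (α / (n + β) - x) ^ 2 - m * n * (α / (n + β) - x)) *
            μBDS n (m - 1) γ α β x := by
  intro x hx
  obtain ⟨m, rfl⟩ : ∃ k, m = k + 1 := ⟨m - 1, by omega⟩
  have hn0 : 0 < n := lt_of_le_of_lt (by positivity) hn
  have hN : 0 < n + β := by linarith
  rw [Nat.add_sub_cancel]
  have hn' := hn
  push_cast at hn'
  set R := fun j => bdsW n γ β j * bdsS n γ j x with hR
  set c := α / (n + β) - x with hc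
  set a := n / (n + β) with ha
  set T := fun j : ℕ => bdsW n γ β j * (bdsS n γ (j + 1) x - (j + n * x) * bdsS n γ j x) with hT
  have hD : x * (1 + γ * x) * (deriv (fun y => μBDS n (m + 1) γ α β y) x +
      ((m + 1 : ℕ) : ℝ) * μBDS n m γ α β x) =
      bdsV T ((Polynomial.X + Polynomial.C c) ^ (m + 1)) := by
    rcases hx.eq_or_lt with h0 | h0
    · have hS : ∀ j, bdsS n γ (j + 1) 0 = 0 := by
        intro j
        refine HasSum.unique (bds_hasSum n γ hγ hn0 (j + 1) 0 le_rfl) ?_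
        convert hasSum_zero using 2 with k
        rcases k with _ | k
        · rw [Nat.zero_ascFactorial]; simp
        · simp [p]
      have hT0 : ∀ j, T j = 0 := by
        intro j
        simp only [hT, ← h0, hS]
        rcases j with _ | j
        · simp
        · simp [hS]
      rw [bdsV_eq _ _ (m + 1) (m + 2) (by omega), ← h0]
      simp [hT0]
    · rw [bds_mu_deriv n γ α β hγ m hn0 hn x h0, bdsV_eq _ _ (m + 1) (m + 2) (by omega),
        bdsV_eq _ _ (m + 1) (m + 2) (by omega)]
      push_cast
      rw [show ∀ u v : ℝ, -((m : ℝ) + 1) * u + v + (m + 1) * u = v by intros; ring,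
        Finset.mul_sum]
      refine Finset.sum_congr rfl fun j _ => ?_
      simp only [hT]
      have h1 : 0 < 1 + γ * x := by positivity
      rw [← hc]
      generalize c ^ (m + 1 - j) = w
      field_simp
  have hsh := bds_shift n γ a x R T (m + 1) (by
    intro j hj
    have hj' : (j : ℝ) ≤ m + 1 := by exact_mod_cast hj
    have := bdsW_succ n γ β hγ j (by nlinarith)
    simp only [hR, hT]
    linear_combination (-bdsS n γ (j + 1) x) * this)
    ((Polynomial.X + Polynomial.C c) ^ (m + 1)) (by simp)
  have e : Polynomial.C n * Polynomial.X * (Polynomial.X + Polynomial.C c) ^ (m + 1)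
      - Polynomial.C γ * Polynomial.X ^ 2 *
        Polynomial.derivative ((Polynomial.X + Polynomial.C c) ^ (m + 1))
      - Polynomial.C a * Polynomial.X *
        Polynomial.derivative ((Polynomial.X + Polynomial.C c) ^ (m + 1))
      - Polynomial.C (a * n * x) * (Polynomial.X + Polynomial.C c) ^ (m + 1)
      = (n - γ * (m + 1)) • (Polynomial.X + Polynomial.C c) ^ (m + 2)
        + (2 * γ * (m + 1) * c - n * c - a * (m + 1) - a * n * x) •
          (Polynomial.X + Polynomial.C c) ^ (m + 1)
        + (a * (m + 1) * c - γ * (m + 1) * c ^ 2) • (Polynomial.X + Polynomial.C c) ^ m := by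
    have hd : Polynomial.derivative ((Polynomial.X + Polynomial.C c) ^ (m + 1)) =
        Polynomial.C ((m : ℝ) + 1) * (Polynomial.X + Polynomial.C c) ^ m := by
      simp [Polynomial.derivative_X_add_C_pow]
    rw [hd]
    simp only [Polynomial.smul_eq_C_mul, map_mul, map_sub, map_add, map_pow, map_one, map_ofNat]
    ring
  rw [e, map_add, map_add, map_smul, map_smul, map_smul, ← hD,
    ← bds_mu_V n γ α β hγ hn0 (m + 2) (by push_cast; linarith) x hx,
    ← bds_mu_V n γ α β hγ hn0 (m + 1) (by push_cast; linarith) x hx,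
    ← bds_mu_V n γ α β hγ hn0 m (by linarith) x hx] at hsh
  simp only [smul_eq_mul] at hsh
  have ha' : (n + β) * a = n := by rw [ha]; field_simp
  have hc' : α - (n + β) * x = (n + β) * c := by rw [hc]; field_simp
  rw [hc']
  generalize deriv (fun y => μBDS n (m + 1) γ α β y) x = d at *
  generalize μBDS n (m + 1 + 1) γ α β x = m2 at *
  generalize μBDS n (m + 1) γ α β x = m1 at *
  generalize μBDS n m γ α β x = m0 at *
  push_cast at hsh ⊢
  linear_combination (-(n + β)) * hsh + (x * (1 + γ * x) * (d + (m + 1) * m0)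
    + ((m + 1) + n * x) * m1 - (m + 1) * c * m0) * ha'
end

section
/- For each fixed x ≥ 0, γ > 0, 0 ≤ α ≤ β, and each m ∈ ℕ, the central moment μ_{n,m,γ}(x) of the modified Baskakov–Durrmeyer–Stancu operator satisfies μ_{n,m,γ}(x) = O(n^{−⌊(m+1)/2⌋}) as n → ∞. -/
open MeasureTheory Filter Real

open Topology Asymptotics

lemma Gamma_add_nat_bds (c : ℝ) (hc : 0 < c) (k : ℕ) :
    Real.Gamma (c + k) = (ascPochhammer ℝ k).eval c * Real.Gamma c := by
  induction k with
  | zero => simp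
  | succ k ih =>
    rw [ascPochhammer_succ_eval]
    push_cast
    rw [← add_assoc, Real.Gamma_add_one (by positivity), ih]
    ring

/-- negative binomial weight -/
noncomputable def nb (c y : ℝ) (k : ℕ) : ℝ :=
  (ascPochhammer ℝ k).eval c / (k.factorial : ℝ) * y ^ k / (1 + y) ^ (c + (k : ℝ))

lemma p_eq_nb (n γ x : ℝ) (hn : 0 < n) (hγ : 0 < γ) (k : ℕ) :
    p n γ k x = nb (n / γ) (γ * x) k := by
  have h : 0 < n / γ := by positivity
  have hG := (Real.Gamma_pos_of_pos h).ne'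
  unfold p nb
  rw [Gamma_add_nat_bds _ h, Real.Gamma_nat_eq_factorial, mul_div_mul_right _ _ hG]

lemma nb_hasSum (c y : ℝ) (hc : 0 < c) (hy : 0 ≤ y) : HasSum (nb c y) 1 := by
  have h1 : 0 < 1 + y := by linarith
  have hz : y / (1 + y) < 1 := by rw [div_lt_one h1]; linarith
  have hz0 : 0 ≤ y / (1 + y) := by positivity
  have := (Real.one_div_one_sub_rpow_hasFPowerSeriesOnBall_zero c).hasSum (y := y / (1 + y)) 
    (by simp [enorm_eq_nnnorm]; rw [← NNReal.coe_lt_coe]; simp [abs_of_nonneg hy, abs_of_pos h1]; exact hz)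
  have h2 : 1 - y / (1 + y) = (1 + y)⁻¹ := by field_simp; ring
  simp only [zero_add, h2] at this
  have h3 := this.mul_left ((1 + y) ^ (-c))
  have h4 : (1 + y) ^ (-c) * (1 / (1 + y)⁻¹ ^ c) = 1 := by
    rw [Real.inv_rpow h1.le, Real.rpow_neg h1.le]
    have := (Real.rpow_pos_of_pos h1 c).ne'
    field_simp
  rw [h4] at h3
  suffices hfun : nb c y = fun k => (1 + y) ^ (-c) * ((FormalMultilinearSeries.ofScalars ℝ
      (fun n : ℕ => Ring.choose (c + (n : ℝ) - 1) n) k) fun _ => y / (1 + y))  from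
    by rw [hfun]; exact h3
  funext k
  simp only [FormalMultilinearSeries.ofScalars_apply_eq, smul_eq_mul]
  rw [← Ring.multichoose_eq]
  have h5 := Ring.factorial_nsmul_multichoose_eq_ascPochhammer c k
  rw [Polynomial.ascPochhammer_smeval_eq_eval, nsmul_eq_mul] at h5
  unfold nb
  rw [← h5, Real.rpow_add h1, Real.rpow_natCast, Real.rpow_neg h1.le, div_pow]
  have := (Real.rpow_pos_of_pos h1 c).ne'
  have : (k.factorial : ℝ) ≠ 0 := by positivity
  field_simp

lemma nb_shift (c y : ℝ) (hc : 0 < c) (hy : 0 ≤ y) (r j : ℕ) :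
    nb c y (j + r) * ((j + r).descFactorial r : ℝ)
      = ((ascPochhammer ℝ r).eval c * y ^ r) * nb (c + r) y j := by
  unfold nb
  have h1 : ((j + r).factorial : ℝ) = j.factorial * ((j + r).descFactorial r : ℝ) := by
    have := Nat.factorial_mul_descFactorial (n := j + r) (k := r) (by omega)
    rw [Nat.add_sub_cancel] at this
    exact_mod_cast this.symm
  have h2 : (ascPochhammer ℝ (j + r)).eval c
      = (ascPochhammer ℝ r).eval c * (ascPochhammer ℝ j).eval (c + r) := by
    have hG := (Real.Gamma_pos_of_pos hc).ne'
    have e1 := Gamma_add_nat_bds c hc (j + r)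
    have e2 := Gamma_add_nat_bds (c + r) (by positivity) j
    have e3 := Gamma_add_nat_bds c hc r
    apply mul_right_cancel₀ hG
    rw [← e1, mul_right_comm, ← e3, mul_comm, ← e2]
    congr 1; push_cast; ring
  have h3 : c + ((j + r : ℕ) : ℝ) = c + r + j := by push_cast; ring
  have h4 : ((j + r).descFactorial r : ℝ) ≠ 0 := by
    have : (j + r).descFactorial r ≠ 0 := by
      rw [Ne, Nat.descFactorial_eq_zero_iff_lt]; omega
    exact_mod_cast this
  have h5 : (j.factorial : ℝ) ≠ 0 := by positivity
  have h6 := (Real.rpow_pos_of_pos (show 0 < 1 + y by linarith) (c + r + j)).ne'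
  rw [h1, h2, h3, pow_add]
  field_simp

lemma nb_desc (c y : ℝ) (hc : 0 < c) (hy : 0 ≤ y) (r : ℕ) :
    HasSum (fun k => nb c y k * (k.descFactorial r : ℝ)) ((ascPochhammer ℝ r).eval c * y ^ r) := by
  have h := (nb_hasSum (c + r) y (by positivity) hy).mul_left ((ascPochhammer ℝ r).eval c * y ^ r)
  simp_rw [← nb_shift c y hc hy r] at h
  rw [mul_one] at h
  have := (hasSum_nat_add_iff (f := fun k => nb c y k * (k.descFactorial r : ℝ)) r).1 h
  rw [Finset.sum_eq_zero, add_zero] at this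
  · exact this
  intro i hi
  rw [Nat.descFactorial_eq_zero_iff_lt.2 (Finset.mem_range.1 hi)]
  simp

open Polynomial in
/-- pairs (function of k, its expectation polynomial) -/
noncomputable def SS (c : ℝ) : Submodule ℝ ((ℕ → ℝ) × ℝ[X]) :=
  Submodule.span ℝ (Set.range fun r : ℕ =>
    ((fun k : ℕ => (k.descFactorial r : ℝ)), C ((ascPochhammer ℝ r).eval c) * X ^ r))

open Polynomial in
lemma SS_hasSum (c y : ℝ) (hc : 0 < c) (hy : 0 ≤ y) (q) (hq : q ∈ SS c) :
    HasSum (fun k => nb c y k * q.1 k) (q.2.eval y) := by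
  induction hq using Submodule.span_induction with
  | mem q h =>
    obtain ⟨r, rfl⟩ := h
    simpa using nb_desc c y hc hy r
  | zero => simp
  | add a b _ _ ha hb =>
    simpa [mul_add] using ha.add hb
  | smul a b _ hb =>
    simpa [mul_left_comm] using hb.mul_left a

open Polynomial in
lemma SS_mul (c : ℝ) (q) (hq : q ∈ SS c) :
    ((fun k : ℕ => (k : ℝ) * q.1 k), X * (1 + X) * derivative q.2 + C c * X * q.2) ∈ SS c := by
  induction hq using Submodule.span_induction with
  | mem q h =>
    obtain ⟨r, rfl⟩ := h
    have e1 := Submodule.subset_span (R := ℝ) (s := Set.range fun r : ℕ =>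
      ((fun k : ℕ => (k.descFactorial r : ℝ)), C ((ascPochhammer ℝ r).eval c) * X ^ r)) ⟨r + 1, rfl⟩
    have e2 := Submodule.subset_span (R := ℝ) (s := Set.range fun r : ℕ =>
      ((fun k : ℕ => (k.descFactorial r : ℝ)), C ((ascPochhammer ℝ r).eval c) * X ^ r)) ⟨r, rfl⟩
    have := (SS c).add_mem e1 ((SS c).smul_mem (r : ℝ) e2)
    convert this using 1
    refine Prod.ext ?_ ?_
    · ext k
      simp only [Prod.fst_add, Prod.smul_fst, Pi.add_apply, Pi.smul_apply, smul_eq_mul]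
      rw [Nat.descFactorial_succ]
      rcases le_or_gt r k with h | h
      · push_cast [h]; ring
      · rw [Nat.descFactorial_eq_zero_iff_lt.2 h]; simp
    · simp only [Prod.snd_add, Prod.smul_snd, smul_eq_C_mul]
      rw [ascPochhammer_succ_eval]
      simp only [derivative_mul, derivative_C, derivative_X_pow, C_mul, C_add]
      rcases r with _ | r
      · simp
      · simp only [Nat.add_sub_cancel]; ring
  | zero =>
    convert (SS c).zero_mem using 1
    refine Prod.ext ?_ ?_
    · ext k; simp
    · simp
  | add a b _ _ ha hb =>
    convert (SS c).add_mem ha hb using 1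
    refine Prod.ext ?_ ?_
    · ext k; simp [mul_add]
    · simp; ring
  | smul a b _ hb =>
    convert (SS c).smul_mem a hb using 1
    refine Prod.ext ?_ ?_
    · ext k; simp [mul_left_comm]
    · simp [smul_eq_C_mul]; ring

noncomputable def gk (c : ℝ) : ℕ → ℕ → ℝ
  | 0, _ => 1
  | i + 1, k => (c - i)⁻¹ * ((k + i) * gk c i k)

open Polynomial in
noncomputable def AA (c : ℝ) : ℕ → ℝ[X]
  | 0 => 1
  | i + 1 => C ((c - i)⁻¹) * (X * (1 + X) * derivative (AA c i) + (C (i : ℝ) + C c * X) * AA c i)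

open Polynomial in
lemma gk_mem (c : ℝ) (i : ℕ) : (gk c i, AA c i) ∈ SS c := by
  induction i with
  | zero =>
    refine Submodule.subset_span ⟨0, ?_⟩
    refine Prod.ext ?_ ?_
    · ext k; simp [gk]
    · simp [AA]
  | succ i ih =>
    convert (SS c).smul_mem ((c - i)⁻¹) ((SS c).add_mem (SS_mul c _ ih) ((SS c).smul_mem (i : ℝ) ih)) using 1
    refine Prod.ext ?_ ?_
    · ext k; simp [gk]; ring
    · simp [AA, smul_eq_C_mul]; ring

lemma gk_hasSum (c y : ℝ) (hc : 0 < c) (hy : 0 ≤ y) (i : ℕ) :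
    HasSum (fun k => nb c y k * gk c i k) ((AA c i).eval y) :=
  SS_hasSum c y hc hy _ (gk_mem c i)

lemma J_integrable (a : ℕ) (s : ℝ) (hs : (a : ℝ) + 1 < s) :
    IntegrableOn (fun t : ℝ => t ^ a * (1 + t) ^ (-s)) (Set.Ioi 0) := by
  have h := integrableOn_add_rpow_Ioi_of_lt (a := a - s) (c := 0) (m := 1) (by linarith) (by norm_num)
  refine Integrable.mono' h ?_ ?_
  · refine ContinuousOn.aestronglyMeasurable ?_ measurableSet_Ioi
    refine ContinuousOn.mul (by fun_prop) (ContinuousOn.rpow_const (by fun_prop) ?_)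
    intro t ht
    left; have : (0:ℝ) < t := ht; linarith
  · refine (ae_restrict_mem measurableSet_Ioi).mono fun t ht => ?_
    have ht : (0:ℝ) < t := ht
    have h1 : 0 < 1 + t := by linarith
    rw [Real.norm_of_nonneg (by positivity), add_comm t 1, sub_eq_add_neg, Real.rpow_add h1, Real.rpow_natCast]
    gcongr
    linarith

lemma J_eq (a : ℕ) : ∀ (s : ℝ), (a : ℝ) + 1 < s →
    ∫ t in Set.Ioi (0:ℝ), t ^ a * (1 + t) ^ (-s) = a.factorial * Real.Gamma (s - a - 1) / Real.Gamma s := by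
  induction a with
  | zero =>
    intro s hs
    simp at hs
    have hd : ∀ t ∈ Set.Ici (0:ℝ), HasDerivAt (fun t : ℝ => (1 + t) ^ (1 - s) / (1 - s)) (t ^ 0 * (1 + t) ^ (-s)) t := by
      intro t ht
      have ht : (0:ℝ) ≤ t := ht
      have := (((hasDerivAt_id t).const_add 1).rpow_const (p := 1 - s) (Or.inl (by simp; linarith))).div_const (1 - s)
      refine HasDerivAt.congr_deriv this ?_
      have : 1 - s ≠ 0 := by linarith
      simp
      field_simp
    have hl : Tendsto (fun t : ℝ => (1 + t) ^ (1 - s) / (1 - s)) atTop (𝓝 (0 / (1 - s))) := by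
      refine Tendsto.div_const ?_ _
      rw [show 1 - s = -(s - 1) by ring]
      exact (tendsto_rpow_neg_atTop (by linarith)).comp (tendsto_atTop_add_const_left _ 1 tendsto_id)
    rw [integral_Ioi_of_hasDerivAt_of_tendsto' hd (J_integrable 0 s (by simpa)) hl]
    have : Real.Gamma s = (s - 1) * Real.Gamma (s - 1) := by
      rw [← Real.Gamma_add_one (by linarith)]; congr 1; ring
    simp [this]
    have h2 := (Real.Gamma_pos_of_pos (show 0 < s - 1 by linarith)).ne'
    have h3 : s - 1 ≠ 0 := by linarith
    have h4 : 1 - s ≠ 0 := by linarith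
    field_simp
    ring
  | succ a ih =>
    intro s hs
    push_cast at hs
    have hd : ∀ t ∈ Set.Ici (0:ℝ), HasDerivAt (fun t : ℝ => t ^ (a + 1) * (1 + t) ^ (1 - s))
        ((a + 1) * (t ^ a * (1 + t) ^ (-(s - 1))) - (s - 1) * (t ^ (a + 1) * (1 + t) ^ (-s))) t := by
      intro t ht
      have ht : (0:ℝ) ≤ t := ht
      have := (hasDerivAt_pow (a + 1) t).mul (((hasDerivAt_id t).const_add 1).rpow_const (p := 1 - s) (Or.inl (by simp; linarith)))
      refine HasDerivAt.congr_deriv this ?_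
      simp
      ring
    have hl : Tendsto (fun t : ℝ => t ^ (a + 1) * (1 + t) ^ (1 - s)) atTop (𝓝 0) := by
      have h0 : Tendsto (fun t : ℝ => (1 + t) ^ (-(s - 1 - (a + 1)))) atTop (𝓝 0) :=
        (tendsto_rpow_neg_atTop (by linarith)).comp (tendsto_atTop_add_const_left _ 1 tendsto_id)
      refine squeeze_zero' ?_ ?_ h0
      · filter_upwards [eventually_gt_atTop 0] with t ht
        positivity
      · filter_upwards [eventually_gt_atTop 0] with t ht
        have h1 : 0 < 1 + t := by linarith
        rw [show -(s - 1 - ((a:ℝ) + 1)) = ((a + 1 : ℕ) : ℝ) + (1 - s) by push_cast; ring,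
          Real.rpow_add h1, Real.rpow_natCast]
        gcongr
        linarith
    have i1 := (J_integrable a (s - 1) (by linarith)).const_mul ((a:ℝ) + 1)
    have i2 := (J_integrable (a + 1) s (by push_cast; linarith)).const_mul (s - 1)
    have key := integral_Ioi_of_hasDerivAt_of_tendsto' hd (i1.sub i2) hl
    rw [integral_sub i1 i2, integral_const_mul, integral_const_mul, ih (s - 1) (by linarith)] at key
    have : Real.Gamma s = (s - 1) * Real.Gamma (s - 1) := by
      rw [← Real.Gamma_add_one (by linarith)]; congr 1; ring
    have h2 := (Real.Gamma_pos_of_pos (show 0 < s - 1 by linarith)).ne'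
    have h3 : s - 1 ≠ 0 := by linarith
    rw [this, Nat.factorial_succ]
    simp at key
    push_cast
    rw [show s - (a + 1) - 1 = s - 1 - a - 1 by ring]
    generalize (∫ t in Set.Ioi (0:ℝ), t ^ (a+1) * (1 + t) ^ (-s)) = I at *
    field_simp at key ⊢
    linarith

noncomputable def bt (c : ℝ) (k : ℕ) : ℝ := Real.Gamma (c + k + 2) / (k.factorial * Real.Gamma (c + 1))

lemma bt_gk (c : ℝ) (hc : 0 < c) (k i : ℕ) (hi : (i:ℝ) < c + 1) :
    bt c k * ((k + i).factorial * Real.Gamma (c + k + 2 - (k + i : ℕ) - 1) / Real.Gamma (c + k + 2))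
      = gk c i (k + 1) := by
  induction i with
  | zero =>
    unfold bt gk
    have h1 := (Real.Gamma_pos_of_pos (show 0 < c + k + 2 by positivity)).ne'
    have h2 := (Real.Gamma_pos_of_pos (show 0 < c + 1 by positivity)).ne'
    have h5 : (k.factorial : ℝ) ≠ 0 := by positivity
    rw [show c + k + 2 - ((k + 0 : ℕ):ℝ) - 1 = c + 1 by push_cast; ring]
    simp
    field_simp
  | succ i ih =>
    push_cast at hi
    have hci : 0 < c - i := by linarith
    rw [gk, ← ih (by linarith)]
    have e : Real.Gamma (c + k + 2 - (k + i : ℕ) - 1) = (c - i) * Real.Gamma (c + k + 2 - (k + (i + 1) : ℕ) - 1) := by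
      rw [show c + k + 2 - (k + (i + 1) : ℕ) - 1 = c - i by push_cast; ring, ← Real.Gamma_add_one hci.ne']
      congr 1; push_cast; ring
    rw [e, ← add_assoc, Nat.factorial_succ]
    push_cast
    field_simp
    ring

lemma b_eq (n γ : ℝ) (hn : 0 < n) (hγ : 0 < γ) (k i : ℕ) (t : ℝ) (ht : 0 < t) :
    b n γ (k + 1) t * (γ * t) ^ i
     = (γ * bt (n / γ) k) * ((γ * t) ^ (k + i) * (1 + γ * t) ^ (-(n / γ + k + 2))) := by
  unfold b bt
  have h1 : 0 < 1 + γ * t := by positivity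
  simp only [Nat.add_sub_cancel]
  push_cast
  rw [Real.Gamma_nat_eq_factorial, Real.rpow_neg h1.le, pow_add,
    show n / γ + (k + 1) + 1 = n / γ + k + 2 by ring]
  ring

lemma b_int (n γ : ℝ) (hn : 0 < n) (hγ : 0 < γ) (k i : ℕ) (hi : (i:ℝ) < n / γ + 1) :
    IntegrableOn (fun t => b n γ (k + 1) t * (γ * t) ^ i) (Set.Ioi 0) ∧
    ∫ t in Set.Ioi (0:ℝ), b n γ (k + 1) t * (γ * t) ^ i = gk (n / γ) i (k + 1) := by
  have hE : Set.EqOn (fun t => b n γ (k + 1) t * (γ * t) ^ i)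
    (fun t => (γ * bt (n / γ) k) * ((γ * t) ^ (k + i) * (1 + γ * t) ^ (-(n / γ + k + 2)))) (Set.Ioi 0) :=
    fun t ht => b_eq n γ hn hγ k i t ht
  have hs : ((k + i : ℕ) : ℝ) + 1 < n / γ + k + 2 := by push_cast; linarith
  constructor
  · refine IntegrableOn.congr_fun ?_ hE.symm measurableSet_Ioi
    refine Integrable.const_mul ?_ _
    have := (integrableOn_Ioi_comp_mul_left_iff (fun t : ℝ => t ^ (k + i) * (1 + t) ^ (-(n / γ + k + 2))) 0 hγ).2
      (by simpa using J_integrable (k + i) (n / γ + k + 2) hs)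
    exact this
  · rw [setIntegral_congr_fun measurableSet_Ioi hE, integral_const_mul,
      integral_comp_mul_left_Ioi (fun t : ℝ => t ^ (k + i) * (1 + t) ^ (-(n / γ + k + 2))) 0 hγ, mul_zero,
      J_eq _ _ hs, ← bt_gk (n / γ) (by positivity) k i hi, smul_eq_mul]
    field_simp

open Polynomial in
noncomputable def WW (c : ℝ) : ℕ → ℕ → ℝ[X]
  | 0, j => AA c j
  | m + 1, j => WW c m (j + 1) - X * WW c m j

open Polynomial in
lemma AA_rec (c : ℝ) (i : ℕ) (hi : (i:ℝ) < c) :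
    X * (1 + X) * derivative (AA c i)
      = C (c - i) * AA c (i + 1) - (C (i:ℝ) + C c * X) * AA c i := by
  rw [AA, ← mul_assoc, ← C_mul, mul_inv_cancel₀ (by linarith), C_1, one_mul]
  ring

open Polynomial in
lemma WW_rec0 (c : ℝ) (j : ℕ) (h : (j:ℝ) < c) :
    X * (1 + X) * derivative (WW c 0 j)
      = C c * WW c 1 j - C (j:ℝ) * (WW c 0 j + WW c 0 (j + 1)) := by
  simp only [WW]
  rw [AA_rec c j h, C_sub]
  ring

open Polynomial in
lemma WW_rec (c : ℝ) (m : ℕ) : ∀ (j : ℕ), ((j + m + 1 : ℕ) :ℝ) < c →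
    X * (1 + X) * derivative (WW c (m + 1) j)
      = - C ((m : ℝ) + 1) * X * (1 + X) * WW c m j + C c * WW c (m + 2) j
        - C (j:ℝ) * (WW c (m + 1) j + WW c (m + 1) (j + 1))
        - C ((m : ℝ) + 1) * (WW c m (j + 1) + WW c m (j + 2)) := by
  induction m with
  | zero =>
    intro j h
    push_cast at h
    have e1 := WW_rec0 c j (by linarith)
    have e2 := WW_rec0 c (j + 1) (by push_cast; linarith)
    have a1 : WW c 2 j = WW c 1 (j + 1) - X * WW c 1 j := rfl
    have a2 : WW c 1 j = WW c 0 (j + 1) - X * WW c 0 j := rfl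
    have a3 : WW c 1 (j + 1) = WW c 0 (j + 2) - X * WW c 0 (j + 1) := rfl
    have d : derivative (WW c 1 j) = derivative (WW c 0 (j + 1)) - WW c 0 j - X * derivative (WW c 0 j) := by
      rw [a2]; simp; ring
    simp only [zero_add]
    rw [d, a1]
    push_cast at e2
    simp only [Nat.cast_zero, C_add, C_1, C_0] at *
    linear_combination e2 - X * e1 + C (j:ℝ) * (a2 + a3)
  | succ m ih =>
    intro j h
    push_cast at h
    have e1 := ih j (by push_cast; linarith)
    have e2 := ih (j + 1) (by push_cast; linarith)
    have a1 : WW c (m + 1 + 2) j = WW c (m + 2) (j + 1) - X * WW c (m + 2) j := rfl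
    have a2 : WW c (m + 1 + 1) j = WW c (m + 1) (j + 1) - X * WW c (m + 1) j := rfl
    have a3 : WW c (m + 1 + 1) (j + 1) = WW c (m + 1) (j + 2) - X * WW c (m + 1) (j + 1) := rfl
    have b1 : WW c (m + 1) j = WW c m (j + 1) - X * WW c m j := rfl
    have b2 : WW c (m + 1) (j + 1) = WW c m (j + 2) - X * WW c m (j + 1) := rfl
    have b3 : WW c (m + 1) (j + 2) = WW c m (j + 3) - X * WW c m (j + 2) := rfl
    have d : derivative (WW c (m + 1 + 1) j) = derivative (WW c (m + 1) (j + 1)) - WW c (m + 1) j - X * derivative (WW c (m + 1) j) := by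
      rw [a2]; simp; ring
    rw [d, a1]
    push_cast at e2 ⊢
    simp only [C_add, C_1] at *
    linear_combination e2 - X * e1 + C (j:ℝ) * (a2 + a3) + (C (m:ℝ) + 1) * X * (1 + X) * b1
      + (C (m:ℝ) + 1) * (b2 + b3)

open Polynomial in
lemma NN_rec (c : ℝ) (m : ℕ) (h : ((m + 1 : ℕ) : ℝ) < c) :
    C (c - (m + 1)) * WW c (m + 2) 0 = X * (1 + X) * derivative (WW c (m + 1) 0)
      + C (2 * ((m:ℝ) + 1)) * (X * (1 + X)) * WW c m 0 + C ((m:ℝ) + 1) * (1 + 2 * X) * WW c (m + 1) 0 := by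
  have e := WW_rec c m 0 (by simpa using h)
  have a1 : WW c (m + 2) 0 = WW c (m + 1) 1 - X * WW c (m + 1) 0 := rfl
  have b1 : WW c (m + 1) 0 = WW c m 1 - X * WW c m 0 := rfl
  have b2 : WW c (m + 1) 1 = WW c m 2 - X * WW c m 1 := rfl
  rw [e]
  have h2 : (C (2:ℝ)) = 2 := rfl
  simp only [C_add, C_1, C_sub, C_mul, h2, Nat.cast_zero, C_0, zero_add] at *
  linear_combination (-(C (m:ℝ) + 1)) * (a1 + b2 + (1 + X) * b1)

open Polynomial in
def OrdB (e : ℕ) (P : ℝ → ℝ[X]) : Prop :=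
  ∀ l : ℝ[X] →ₗ[ℝ] ℝ, (fun c => l (P c)) =O[atTop] (fun c : ℝ => (c ^ e)⁻¹)

open Polynomial in
lemma OrdB.add {e : ℕ} {P Q : ℝ → ℝ[X]} (hP : OrdB e P) (hQ : OrdB e Q) : OrdB e (fun c => P c + Q c) := by
  intro l
  simpa using (hP l).add (hQ l)

open Polynomial in
lemma OrdB.map {e : ℕ} {P : ℝ → ℝ[X]} (hP : OrdB e P) (T : ℝ[X] →ₗ[ℝ] ℝ[X]) : OrdB e (fun c => T (P c)) := by
  intro l
  simpa using hP (l.comp T)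

open Polynomial in
lemma OrdB.mulLeft {e : ℕ} {P : ℝ → ℝ[X]} (hP : OrdB e P) (q : ℝ[X]) : OrdB e (fun c => q * (P c)) :=
  hP.map (LinearMap.mulLeft ℝ q)

lemma inv_pow_isBigO {e e' : ℕ} (h : e' ≤ e) :
    (fun c : ℝ => (c ^ e)⁻¹) =O[atTop] (fun c : ℝ => (c ^ e')⁻¹) := by
  refine IsBigO.of_bound 1 ?_
  filter_upwards [eventually_ge_atTop 1] with c hc
  rw [Real.norm_of_nonneg (by positivity), Real.norm_of_nonneg (by positivity), one_mul]
  gcongr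

open Polynomial in
lemma OrdB.mono {e e' : ℕ} {P : ℝ → ℝ[X]} (hP : OrdB e P) (h : e' ≤ e) : OrdB e' P :=
  fun l => (hP l).trans (inv_pow_isBigO h)

open Polynomial in
lemma OrdB.div {e : ℕ} {P Q : ℝ → ℝ[X]} (hP : OrdB e P) (a : ℝ)
    (h : ∀ᶠ c in atTop, C (c - a) * Q c = P c) : OrdB (e + 1) Q := by
  intro l
  have h1 : (fun c => l (Q c)) =ᶠ[atTop] fun c => (c - a)⁻¹ * l (P c) := by
    filter_upwards [h, eventually_gt_atTop a] with c hc hca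
    rw [← hc, ← smul_eq_C_mul, map_smul, smul_eq_mul, ← mul_assoc, inv_mul_cancel₀ (by linarith), one_mul]
  have h2 : (fun c : ℝ => (c - a)⁻¹) =O[atTop] (fun c : ℝ => c⁻¹) := by
    refine IsBigO.of_bound 2 ?_
    filter_upwards [eventually_gt_atTop (2 * |a|), eventually_gt_atTop 0] with c hc h0
    have := le_abs_self a
    have h3 : 0 < c - a := by linarith
    rw [Real.norm_of_nonneg (by positivity), Real.norm_of_nonneg (by positivity)]
    rw [← div_eq_mul_inv, inv_eq_one_div, div_le_div_iff₀ h3 h0]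
    linarith
  refine h1.trans_isBigO ((h2.mul (hP l)).trans (IsBigO.of_bound 1 (Eventually.of_forall fun c => ?_)))
  rw [one_mul, pow_succ, mul_inv, mul_comm]

open Polynomial in
lemma NN_ord (m : ℕ) : OrdB ((m + 1) / 2) (fun c => WW c m 0) ∧ OrdB ((m + 2) / 2) (fun c => WW c (m + 1) 0) := by
  induction m with
  | zero =>
    constructor
    · intro l
      simp only [WW, AA]
      simpa using isBigO_const_const (l 1) (one_ne_zero (α := ℝ)) atTop
    · intro l
      refine IsBigO.congr' (isBigO_zero _ _) ?_ EventuallyEq.rfl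
      filter_upwards [eventually_gt_atTop 0] with c hc
      have : WW c (0 + 1) 0 = 0 := by
        simp only [WW, AA]
        simp
        rw [← mul_assoc, ← C_mul, inv_mul_cancel₀ hc.ne']
        simp
      rw [this, map_zero]
  | succ m ih =>
    refine ⟨ih.2, ?_⟩
    obtain ⟨h0, h1⟩ := ih
    have e1 : (m + 1) / 2 ≤ (m + 2) / 2 := by omega
    have e2 : (m + 1 + 2) / 2 = (m + 1) / 2 + 1 := by omega
    rw [e2]
    have t1 := ((h1.mono e1).map derivative).mulLeft (X * (1 + X))
    have t2 := h0.mulLeft (C (2 * ((m:ℝ) + 1)) * (X * (1 + X)))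
    have t3 := (h1.mono e1).mulLeft (C ((m:ℝ) + 1) * (1 + 2 * X))
    refine ((t1.add t2).add t3).div ((m:ℝ) + 1) ?_
    filter_upwards [eventually_gt_atTop ((m + 1 : ℕ) : ℝ)] with c hc
    exact NN_rec c m hc

def HasL (n γ x : ℝ) (F : ℝ → ℝ) (v : ℝ) : Prop :=
  (∀ k : ℕ, IntegrableOn (fun t => b n γ (k + 1) t * F t) (Set.Ioi 0)) ∧
  HasSum (fun k : ℕ => p n γ (k + 1) x * ∫ t in Set.Ioi (0 : ℝ), b n γ (k + 1) t * F t)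
    (v - p n γ 0 x * F 0)

lemma HasL.add {n γ x : ℝ} {F G : ℝ → ℝ} {v w : ℝ} (hF : HasL n γ x F v) (hG : HasL n γ x G w) :
    HasL n γ x (fun t => F t + G t) (v + w) := by
  refine ⟨fun k => ?_, ?_⟩
  · simp only [mul_add]
    exact (hF.1 k).add (hG.1 k)
  · have := hF.2.add hG.2
    have e : ∀ k : ℕ, ∫ t in Set.Ioi (0 : ℝ), b n γ (k + 1) t * (F t + G t)
        = (∫ t in Set.Ioi (0 : ℝ), b n γ (k + 1) t * F t) + ∫ t in Set.Ioi (0 : ℝ), b n γ (k + 1) t * G t := by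
      intro k
      simp only [mul_add]
      exact integral_add (hF.1 k) (hG.1 k)
    simp only [e]
    simp only [mul_add]
    rw [show v + w - (p n γ 0 x * F 0 + p n γ 0 x * G 0)
      = v - p n γ 0 x * F 0 + (w - p n γ 0 x * G 0) by ring]
    exact this

lemma HasL.const_mul {n γ x : ℝ} {F : ℝ → ℝ} {v : ℝ} (a : ℝ) (hF : HasL n γ x F v) :
    HasL n γ x (fun t => a * F t) (a * v) := by
  refine ⟨fun k => ?_, ?_⟩
  · simp only [mul_left_comm _ a]
    exact (hF.1 k).const_mul a
  · have := hF.2.mul_left a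
    simp only [mul_left_comm _ a, integral_const_mul]
    rw [← mul_sub]
    exact this

lemma HasL.zero {n γ x : ℝ} : HasL n γ x (fun _ => 0) 0 := by
  refine ⟨fun k => by simp, ?_⟩
  simp

lemma HasL.sum {n γ x : ℝ} {F : ℕ → ℝ → ℝ} {v : ℕ → ℝ} (N : ℕ)
    (h : ∀ i < N, HasL n γ x (F i) (v i)) :
    HasL n γ x (fun t => ∑ i ∈ Finset.range N, F i t) (∑ i ∈ Finset.range N, v i) := by
  induction N with
  | zero => simpa using HasL.zero
  | succ N ih =>
    simp only [Finset.sum_range_succ]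
    exact (ih fun i hi => h i (by omega)).add (h N (by omega))

lemma HasL_WW (n γ x : ℝ) (hn : 0 < n) (hγ : 0 < γ) (hx : 0 ≤ x) (m : ℕ) :
    ∀ j : ℕ, ((j + m : ℕ) : ℝ) < n / γ + 1 →
    HasL n γ x (fun t => (γ * t) ^ j * (γ * t - γ * x) ^ m) ((WW (n / γ) m j).eval (γ * x)) := by
  induction m with
  | zero =>
    intro j hj
    simp only [pow_zero, mul_one, WW]
    have hb := fun k => b_int n γ hn hγ k j (by simpa using hj)
    refine ⟨fun k => (hb k).1, ?_⟩
    simp only [(hb _).2, p_eq_nb n γ x hn hγ]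
    have h := gk_hasSum (n / γ) (γ * x) (by positivity) (by positivity) j
    have h0 : (γ * 0) ^ j = gk (n / γ) j 0 := by
      clear hb h hj
      induction j with
      | zero => simp [gk]
      | succ j ih =>
        rw [gk, ← ih]
        rcases j with _ | j <;> simp
    rw [h0]
    have h' := (hasSum_nat_add_iff' (f := fun k => nb (n / γ) (γ * x) k * gk (n / γ) j k) 1).2 h
    rw [Finset.sum_range_one] at h'
    exact h'
  | succ m ih =>
    intro j hj
    have h1 := (ih (j + 1) (by push_cast at hj ⊢; linarith)).add
      ((ih j (by push_cast at hj ⊢; linarith)).const_mul (-(γ * x)))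
    convert h1 using 1
    · funext t; ring
    · simp [WW]; ring

lemma μ_eq (γ α β x : ℝ) (m : ℕ) (hx : 0 ≤ x) (hγ : 0 < γ) (hβ : 0 ≤ β) (n : ℝ) (hn : 0 < n)
    (hm : (m : ℝ) < n / γ + 1) :
    μBDS n m γ α β x = ((n + β) ^ m)⁻¹ * ∑ i ∈ Finset.range (m + 1),
      ((α - β * x) ^ (m - i) * m.choose i) * ((n / γ) ^ i * (WW (n / γ) i 0).eval (γ * x)) := by
  have hnb : n + β ≠ 0 := by positivity
  have key := (HasL.sum (n := n) (γ := γ) (x := x) (m + 1) (fun i hi =>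
    ((HasL_WW n γ x hn hγ hx i 0 (by
      have : (i : ℝ) ≤ m := by exact_mod_cast Nat.lt_succ_iff.1 hi
      simp; linarith)).const_mul ((n / γ) ^ i)).const_mul
      ((α - β * x) ^ (m - i) * m.choose i))).const_mul ((n + β) ^ m)⁻¹
  have hF : (fun t : ℝ => ((n * t + α) / (n + β) - x) ^ m) = fun t => ((n + β) ^ m)⁻¹ * ∑ i ∈ Finset.range (m + 1),
      ((α - β * x) ^ (m - i) * m.choose i) * ((n / γ) ^ i * ((γ * t) ^ 0 * (γ * t - γ * x) ^ i)) := by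
    funext t
    have : (n * t + α) / (n + β) - x = (n + β)⁻¹ * ((n / γ) * (γ * t - γ * x) + (α - β * x)) := by
      field_simp; ring
    rw [this, mul_pow, inv_pow]
    congr 1
    rw [add_pow]
    apply Finset.sum_congr rfl
    intro i _
    rw [mul_pow]; ring
  rw [← hF] at key
  have h2 := key.2.tsum_eq
  unfold μBDS B
  simp only [mul_zero, zero_add] at h2 ⊢
  rw [h2]
  ring

lemma term_bigO (y : ℝ) (m i : ℕ) (hi : i ≤ m) :
    (fun c : ℝ => c ^ i * (WW c i 0).eval y) =O[atTop] (fun c : ℝ => c ^ (m / 2)) := by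
  have h := (NN_ord i).1 (Polynomial.leval y)
  have h2 := (isBigO_refl (fun c : ℝ => c ^ i) atTop).mul h
  refine h2.trans (IsBigO.of_bound 1 ?_)
  filter_upwards [eventually_ge_atTop 1] with c hc
  have e : i = i / 2 + (i + 1) / 2 := by omega
  have hc0 : c ^ ((i + 1) / 2) ≠ 0 := by positivity
  have : c ^ i * (c ^ ((i + 1) / 2))⁻¹ = c ^ (i / 2) := by
    nth_rewrite 1 [e]
    rw [pow_add]; field_simp
  rw [this, Real.norm_of_nonneg (by positivity), Real.norm_of_nonneg (by positivity), one_mul]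
  exact pow_le_pow_right₀ hc (by omega)

theorem BDS_central_moment_order (γ α β x : ℝ) (m : ℕ)
    (hx : 0 ≤ x) (hγ : 0 < γ) (hα : 0 ≤ α) (hαβ : α ≤ β) :
    ∃ C > 0, ∀ᶠ n : ℝ in atTop,
      |μBDS n m γ α β x| ≤ C * n ^ (-(⌊((m : ℝ) + 1) / 2⌋ : ℝ)) := by
  have hβ : 0 ≤ β := hα.trans hαβ
  have hfl : ⌊((m : ℝ) + 1) / 2⌋ = (((m + 1) / 2 : ℕ) : ℤ) := by
    have := Nat.floor_div_eq_div (K := ℝ) (m + 1) 2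
    rw [← this, Int.natCast_floor_eq_floor (by positivity)]
    push_cast; rfl
  have hS : (fun c : ℝ => ∑ i ∈ Finset.range (m + 1),
      ((α - β * x) ^ (m - i) * m.choose i) * (c ^ i * (WW c i 0).eval (γ * x)))
      =O[atTop] (fun c : ℝ => c ^ (m / 2)) := by
    apply IsBigO.fun_sum
    intro i hi
    exact (term_bigO (γ * x) m i (Nat.lt_succ_iff.1 (Finset.mem_range.1 hi))).const_mul_left _
  obtain ⟨C, hC, hb⟩ := hS.exists_pos
  have hb := hb.bound
  have ht : Tendsto (fun n : ℝ => n / γ) atTop atTop := tendsto_id.atTop_div_const hγ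
  refine ⟨C * (γ ^ (m / 2))⁻¹, by positivity, ?_⟩
  filter_upwards [ht.eventually hb, eventually_gt_atTop 0, ht.eventually (eventually_gt_atTop (m : ℝ))]
    with n h1 hn h2
  rw [μ_eq γ α β x m hx hγ hβ n hn (by linarith), hfl, abs_mul, abs_of_nonneg (by positivity)]
  rw [Real.norm_eq_abs, Real.norm_of_nonneg (by positivity)] at h1
  have h3 : ((n + β) ^ m)⁻¹ ≤ (n ^ m)⁻¹ := by gcongr; linarith
  refine (mul_le_mul h3 h1 (abs_nonneg _) (by positivity)).trans (le_of_eq ?_)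
  rw [Real.rpow_neg hn.le]
  rw [Int.cast_natCast, Real.rpow_natCast, div_pow]
  have e : n ^ m = n ^ (m / 2) * n ^ ((m + 1) / 2) := by
    rw [← pow_add]; congr 1; omega
  rw [e]
  field_simp
end

section
/- Let f ∈ C_μ[0,∞) (continuous with |f(t)| ≤ M·t^μ for some M, μ > 0) and suppose f'' exists at a point x ∈ (0,∞). Then lim_{n→∞} n·(B_{n,γ}^{α,β}(f, x) − f(x)) = (α − βx)·f'(x) + x(1+γx)·f''(x) (the Voronovskaja-type asymptotic formula for r = 0). -/
open MeasureTheory Filter Real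

noncomputable def ri : ℕ → ℝ → ℝ
  | 0, _ => 1
  | j + 1, z => z * ri j (z + 1)

lemma ri_nonneg (j : ℕ) : ∀ z : ℝ, 0 ≤ z → 0 ≤ ri j z := by
  induction j with
  | zero => intro z _; simp [ri]
  | succ j ih => intro z hz; exact mul_nonneg hz (ih _ (by linarith))

lemma Gamma_add_nat (j : ℕ) : ∀ z : ℝ, 0 < z → Real.Gamma (z + j) = ri j z * Real.Gamma z := by
  induction j with
  | zero => intro z _; simp [ri]
  | succ j ih =>
    intro z hz
    have := ih (z + 1) (by linarith)
    rw [Real.Gamma_add_one hz.ne'] at this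
    simp only [ri]
    push_cast
    rw [show z + ((j : ℝ) + 1) = z + 1 + j by ring, this]; ring

noncomputable def q (c y : ℝ) (k : ℕ) : ℝ :=
  Real.Gamma (c + (k : ℝ)) / (Real.Gamma ((k : ℝ) + 1) * Real.Gamma c) *
    y ^ k / (1 + y) ^ (c + (k : ℝ))

lemma q_nonneg {c y : ℝ} (hc : 0 < c) (hy : 0 < y) (k : ℕ) : 0 ≤ q c y k := by
  unfold q
  have h1 := Real.Gamma_pos_of_pos (show 0 < c + (k : ℝ) by positivity)
  have h2 := Real.Gamma_pos_of_pos (show 0 < (k : ℝ) + 1 by positivity)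
  have h3 := Real.Gamma_pos_of_pos hc
  positivity

lemma ri_eq (k : ℕ) : ∀ c : ℝ, ri k c = Polynomial.eval c (ascPochhammer ℝ k) := by
  induction k with
  | zero => intro c; simp [ri]
  | succ k ih => intro c; rw [ascPochhammer_succ_left]; simp [ri, ih]

lemma choose_eq {c : ℝ} (hc : 0 < c) (k : ℕ) :
    Ring.choose (c + k - 1) k = Real.Gamma (c + (k : ℝ)) / (Real.Gamma ((k : ℝ) + 1) * Real.Gamma c) := by
  have h := Ring.factorial_nsmul_multichoose_eq_ascPochhammer c k
  rw [Polynomial.ascPochhammer_smeval_eq_eval, ← ri_eq, Ring.multichoose_eq] at h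
  rw [Gamma_add_nat k c hc, Real.Gamma_nat_eq_factorial, ← h]
  have h3 := (Real.Gamma_pos_of_pos hc).ne'
  have h4 : (k.factorial : ℝ) ≠ 0 := by positivity
  rw [nsmul_eq_mul]
  field_simp

lemma q_sum {c y : ℝ} (hc : 0 < c) (hy : 0 < y) : HasSum (q c y) 1 := by
  have hz : y / (1 + y) < 1 := by rw [div_lt_one (by linarith)]; linarith
  have hz0 : 0 < y / (1 + y) := by positivity
  have h := (Real.one_div_one_sub_rpow_hasFPowerSeriesOnBall_zero c).hasSum (y := y / (1 + y))
    (by rw [Metric.mem_eball, edist_zero_right, ← ofReal_norm, Real.norm_of_nonneg hz0.le, ENNReal.ofReal_lt_one]; exact hz)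
  simp only [FormalMultilinearSeries.ofScalars_apply_eq, zero_add] at h
  have h2 := h.mul_left ((1 + y) ^ (-c))
  convert! h2 using 1
  · ext k
    rw [choose_eq hc, q, Real.rpow_add (by linarith), Real.rpow_neg (by linarith), Real.rpow_natCast, smul_eq_mul, div_pow]
    field_simp
  · have : 1 - y / (1 + y) = (1 + y)⁻¹ := by field_simp; ring
    rw [this, Real.inv_rpow (by linarith), Real.rpow_neg (by linarith)]
    have : (1 + y) ^ c ≠ 0 := by positivity
    field_simp

lemma q_shift {c y : ℝ} (hc : 0 < c) (k : ℕ) :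
    q c y (k + 1) * ((k + 1 : ℕ) : ℝ) = c * y * q (c + 1) y k := by
  unfold q
  have h2 := (Real.Gamma_pos_of_pos (show 0 < (k : ℝ) + 1 by positivity)).ne'
  have h3 := (Real.Gamma_pos_of_pos hc).ne'
  have h4 : (k : ℝ) + 1 ≠ 0 := by positivity
  push_cast
  rw [Real.Gamma_add_one hc.ne', Real.Gamma_add_one h4, show c + ((k : ℝ) + 1) = c + 1 + k by ring, pow_succ]
  field_simp

noncomputable def F (y : ℝ) : ℕ → ℝ → ℝ → ℝ
  | 0, _, _ => 1
  | j + 1, a, c => a * F y j (a + 1) c + c * y * F y j (a + 2) (c + 1)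

lemma F_sum {y : ℝ} (hy : 0 < y) (j : ℕ) : ∀ a c : ℝ, 0 < c →
    HasSum (fun k : ℕ => q c y k * ri j (k + a)) (F y j a c) := by
  induction j with
  | zero => intro a c hc; simpa [ri, F] using q_sum hc hy
  | succ j ih =>
    intro a c hc
    have h1 := (ih (a + 1) c hc).mul_left a
    have h2 := (ih (a + 2) (c + 1) (by linarith)).mul_left (c * y)
    have h3 : HasSum (fun k : ℕ => q c y k * (k : ℝ) * ri j (k + a + 1)) (c * y * F y j (a + 2) (c + 1)) := by
      rw [← hasSum_nat_add_iff' 1]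
      simp only [Finset.range_one, Finset.sum_singleton, Nat.cast_zero, mul_zero, zero_mul, sub_zero]
      convert! h2 using 1
      ext k
      rw [q_shift hc, ← mul_assoc]
      congr 2
      push_cast; ring
    convert! h1.add h3 using 1
    ext k
    simp only [ri, ← add_assoc]; ring

open Topology in
def E1 (A : ℝ → ℝ) (a0 a1 : ℝ) : Prop := Tendsto (fun c => c * (A c - a0)) atTop (𝓝 a1)

open Topology in
lemma E1.tendsto {A : ℝ → ℝ} {a0 a1 : ℝ} (h : E1 A a0 a1) : Tendsto A atTop (𝓝 a0) := by
  have h1 : Tendsto (fun c : ℝ => c⁻¹ * (c * (A c - a0)) + a0) atTop (𝓝 (0 * a1 + a0)) :=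
    (tendsto_inv_atTop_zero.mul h).add_const _
  rw [zero_mul, zero_add] at h1
  refine h1.congr' ?_
  filter_upwards [eventually_gt_atTop 0] with c hc
  field_simp; ring

lemma E1.mul {A B : ℝ → ℝ} {a0 a1 b0 b1 : ℝ} (h : E1 A a0 a1) (h' : E1 B b0 b1) :
    E1 (fun c => A c * B c) (a0 * b0) (a1 * b0 + a0 * b1) := by
  refine ((Tendsto.mul h h'.tendsto).add (h'.const_mul a0)).congr ?_
  intro c; ring

lemma E1.congr {A B : ℝ → ℝ} {a0 a1 : ℝ} (h : E1 A a0 a1) (h' : A =ᶠ[atTop] B) : E1 B a0 a1 :=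
  Tendsto.congr' (by filter_upwards [h'] with c hc; rw [hc]) h

lemma E1.const (a : ℝ) : E1 (fun _ => a) a 0 := by simp [E1]

lemma E1.add {A B : ℝ → ℝ} {a0 a1 b0 b1 : ℝ} (h : E1 A a0 a1) (h' : E1 B b0 b1) :
    E1 (fun c => A c + B c) (a0 + b0) (a1 + b1) := by
  refine (Tendsto.add h h').congr ?_
  intro c; ring

lemma E1.pow {A : ℝ → ℝ} {a1 : ℝ} (h : E1 A 1 a1) (j : ℕ) : E1 (fun c => A c ^ j) 1 (j * a1) := by
  induction j with
  | zero => simpa using E1.const 1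
  | succ j ih =>
    have := ih.mul h
    simp only [pow_succ]
    convert this using 1 <;> push_cast <;> ring

lemma E1_frac (i : ℝ) : E1 (fun c => c / (c - i)) 1 i := by
  have h1 : Tendsto (fun c : ℝ => i + i ^ 2 * (c - i)⁻¹) atTop (nhds (i + i ^ 2 * 0)) :=
    ((tendsto_inv_atTop_zero.comp (tendsto_atTop_add_const_right _ (-i) tendsto_id)).const_mul _).const_add _
  rw [mul_zero, add_zero] at h1
  refine h1.congr' ?_
  filter_upwards [eventually_gt_atTop i] with c hc
  have : c - i ≠ 0 := by linarith
  field_simp; ring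

lemma E1_frac1 : E1 (fun c => (c + 1) / c) 1 1 := by
  refine (tendsto_const_nhds (x := (1:ℝ))).congr' ?_
  filter_upwards [eventually_gt_atTop 0] with c hc
  field_simp; ring

lemma E1.shift {A : ℝ → ℝ} {a0 a1 : ℝ} (h : E1 A a0 a1) : E1 (fun c => A (c + 1)) a0 a1 := by
  have h0 : Tendsto (fun c : ℝ => c + 1) atTop atTop := tendsto_atTop_add_const_right _ 1 tendsto_id
  have h1 := h.comp h0
  have h2 := (E1.tendsto h).comp h0
  have := (h1.sub h2).add_const a0
  simp only [sub_add_cancel] at this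
  refine this.congr ?_
  intro c; simp only [Function.comp]; ring

lemma E1_F (y : ℝ) (j : ℕ) : ∀ a : ℝ, E1 (fun c => F y j a c / c ^ j) (y ^ j)
    (j * (a + j - 1) * y ^ (j - 1) + j * (j - 1) / 2 * y ^ j) := by
  induction j with
  | zero => intro a; simpa [F] using E1.const 1
  | succ j ih =>
    intro a
    have h1 := (((ih (a + 2)).shift.mul (E1_frac1.pow j)).mul (E1.const y))
    have h2 : E1 (fun c => a * (F y j (a + 1) c / c ^ j) / c) 0 (a * y ^ j) := by
      refine ((ih (a + 1)).tendsto.const_mul a).congr' ?_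
      filter_upwards [eventually_gt_atTop 0] with c hc
      field_simp; ring
    have h3 := h2.add h1
    have h4 := h3.congr (B := fun c => F y (j + 1) a c / c ^ (j + 1)) ?_
    · convert h4 using 1
      · ring
      · rcases j with _ | j
        · simp
        · simp only [Nat.add_sub_cancel]; push_cast; ring
    · filter_upwards [eventually_gt_atTop 0] with c hc
      simp only [F, div_pow]
      field_simp
      ring

lemma E1_G (j : ℕ) : E1 (fun c => c ^ j * Real.Gamma (c + 1 - j) / Real.Gamma (c + 1)) 1 (j * (j - 1) / 2) := by
  induction j with
  | zero =>
    have := (E1.const 1).congr (B := fun c => c ^ 0 * Real.Gamma (c + 1 - (0:ℕ)) / Real.Gamma (c + 1)) ?_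
    · simpa using this
    · filter_upwards [eventually_gt_atTop 0] with c hc
      have := (Real.Gamma_pos_of_pos (show 0 < c + 1 by linarith)).ne'
      simp [this]
  | succ j ih =>
    have h := (ih.mul (E1_frac j)).congr (B := fun c => c ^ (j + 1) * Real.Gamma (c + 1 - (j + 1 : ℕ)) / Real.Gamma (c + 1)) ?_
    · convert h using 1 <;> push_cast <;> ring
    · filter_upwards [eventually_gt_atTop (j : ℝ)] with c hc
      have h0 : c - j ≠ 0 := by linarith
      push_cast
      rw [show c + 1 - j = c - j + 1 by ring, Real.Gamma_add_one h0, show c + 1 - ((j : ℝ) + 1) = c - j by ring]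
      field_simp
      ring

lemma E1_moment {γ x : ℝ} (hγ : 0 < γ) (j : ℕ) :
    E1 (fun c => F (γ * x) j 0 c * Real.Gamma (c + 1 - j) / Real.Gamma (c + 1) / γ ^ j) (x ^ j)
      (j * (j - 1) * x ^ (j - 1) * (1 + γ * x) / γ) := by
  have h := ((E1_F (γ * x) j 0).mul (E1_G j)).mul (E1.const (1 / γ ^ j))
  have h2 := h.congr (B := fun c => F (γ * x) j 0 c * Real.Gamma (c + 1 - j) / Real.Gamma (c + 1) / γ ^ j) ?_
  · convert! h2 using 1
    · rw [mul_pow]; field_simp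
    · rcases j with _ | j
      · simp
      · simp only [Nat.add_sub_cancel, mul_pow]; push_cast; field_simp; ring
  · filter_upwards [eventually_gt_atTop 0] with c hc
    field_simp

lemma J_int (m : ℕ) : ∀ r : ℝ, (m : ℝ) + 1 < r →
    IntegrableOn (fun s : ℝ => s ^ m * (1 + s) ^ (-r)) (Set.Ioi 0) ∧
    ∫ s in Set.Ioi (0 : ℝ), s ^ m * (1 + s) ^ (-r) =
      Real.Gamma (m + 1) * Real.Gamma (r - m - 1) / Real.Gamma r := by
  induction m with
  | zero =>
    intro r hr
    simp only [Nat.cast_zero, zero_add] at hr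
    have h1 : IntegrableOn (fun s : ℝ => (1 + s) ^ (-r)) (Set.Ioi 0) := by
      simpa [add_comm] using integrableOn_add_rpow_Ioi_of_lt (a := -r) (c := 0) (m := 1) (by linarith) (by norm_num)
    refine ⟨by simpa using h1, ?_⟩
    have h2 := MeasureTheory.integral_Ioi_of_hasDerivAt_of_tendsto' (a := (0:ℝ)) (m := (0:ℝ))
      (f := fun s : ℝ => (1 + s) ^ (-r + 1) / (-r + 1)) (f' := fun s : ℝ => (1 + s) ^ (-r)) ?_ h1 ?_
    · simp only [pow_zero, one_mul, h2]
      have h3 : r - 1 ≠ 0 := by linarith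
      have h4 := Real.Gamma_add_one h3
      have h5 := (Real.Gamma_pos_of_pos (show 0 < r - 1 by linarith)).ne'
      have h6 : -r + 1 ≠ 0 := by linarith
      rw [sub_add_cancel] at h4
      simp [h4]
      field_simp
      ring
    · intro s hs
      have hs' : (0:ℝ) ≤ s := hs
      have h0 : HasDerivAt (fun s : ℝ => 1 + s) 1 s := (hasDerivAt_id s).const_add 1
      have h7 := (h0.rpow_const (p := -r + 1) (Or.inl (by linarith))).div_const (-r + 1)
      have h6 : -r + 1 ≠ 0 := by linarith
      refine h7.congr_deriv ?_
      rw [add_sub_cancel_right]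
      field_simp
    · have h8 : Tendsto (fun s : ℝ => (1 + s) ^ (-(r - 1))) atTop (nhds 0) :=
        (tendsto_rpow_neg_atTop (by linarith)).comp (tendsto_atTop_add_const_left _ 1 tendsto_id)
      have h9 := h8.div_const (-r + 1)
      simpa [show -(r - 1) = -r + 1 by ring] using h9
  | succ m ih =>
    intro r hr
    push_cast at hr
    obtain ⟨i1, e1⟩ := ih (r - 1) (by linarith)
    obtain ⟨i2, e2⟩ := ih r (by linarith)
    have hEq : Set.EqOn (fun s : ℝ => s ^ m * (1 + s) ^ (-(r - 1)) - s ^ m * (1 + s) ^ (-r))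
        (fun s : ℝ => s ^ (m + 1) * (1 + s) ^ (-r)) (Set.Ioi 0) := by
      intro s hs
      have hs' : (0:ℝ) < s := hs
      simp only
      rw [show -(r - 1) = -r + 1 by ring, Real.rpow_add (by linarith), Real.rpow_one]
      ring
    refine ⟨(i1.sub i2).congr_fun hEq measurableSet_Ioi, ?_⟩
    rw [← setIntegral_congr_fun measurableSet_Ioi hEq, integral_sub i1 i2, e1, e2]
    push_cast
    have h1 : r - 1 ≠ 0 := by have : (0:ℝ) ≤ m := by positivity
                              linarith
    have h2 : r - m - 2 ≠ 0 := by linarith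
    have h3 : (m : ℝ) + 1 ≠ 0 := by positivity
    have g1 := Real.Gamma_add_one h1
    have g2 := Real.Gamma_add_one h2
    rw [sub_add_cancel] at g1
    rw [show r - (m:ℝ) - 2 + 1 = r - m - 1 by ring] at g2
    rw [Real.Gamma_add_one h3, g1, g2, show r - 1 - (m:ℝ) - 1 = r - m - 2 by ring,
      show r - ((m:ℝ) + 1) - 1 = r - m - 2 by ring]
    have g3 := (Real.Gamma_pos_of_pos (show 0 < r - 1 by
      have : (0:ℝ) ≤ m := by positivity
      linarith)).ne'
    field_simp
    ring

lemma b_nonneg {n γ t : ℝ} (hn : 0 < n) (hγ : 0 < γ) (ht : 0 < t) (k : ℕ) : 0 ≤ b n γ (k + 1) t := by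
  unfold b
  have h1 := Real.Gamma_pos_of_pos (show 0 < n / γ + ((k + 1 : ℕ) : ℝ) + 1 by positivity)
  have h2 := Real.Gamma_pos_of_pos (show 0 < ((k + 1 : ℕ) : ℝ) by positivity)
  have h3 := Real.Gamma_pos_of_pos (show 0 < n / γ + 1 by positivity)
  positivity

lemma b_moment {n γ : ℝ} (hn : 0 < n) (hγ : 0 < γ) (k j : ℕ) (hj : (j : ℝ) < n / γ + 1) :
    IntegrableOn (fun t : ℝ => b n γ (k + 1) t * t ^ j) (Set.Ioi 0) ∧
    ∫ t in Set.Ioi (0 : ℝ), b n γ (k + 1) t * t ^ j =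
      ri j ((k + 1 : ℕ) : ℝ) * (Real.Gamma (n / γ + 1 - j) / Real.Gamma (n / γ + 1) / γ ^ j) := by
  set c := n / γ with hc
  have hc0 : 0 < c := by positivity
  obtain ⟨i1, e1⟩ := J_int (k + j) (c + ((k + 1 : ℕ) : ℝ) + 1) (by push_cast; linarith)
  set K := γ * Real.Gamma (c + ((k + 1 : ℕ) : ℝ) + 1) / (Real.Gamma ((k + 1 : ℕ) : ℝ) * Real.Gamma (c + 1)) / γ ^ j with hK
  have hEq : Set.EqOn (fun t : ℝ => K * ((γ * t) ^ (k + j) * (1 + γ * t) ^ (-(c + ((k + 1 : ℕ) : ℝ) + 1))))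
      (fun t : ℝ => b n γ (k + 1) t * t ^ j) (Set.Ioi 0) := by
    intro t ht
    have ht' : (0:ℝ) < t := ht
    simp only [b, ← hc, hK, Nat.add_sub_cancel]
    rw [Real.rpow_neg (by positivity), pow_add, mul_pow γ t j]
    field_simp
  have i2 := (integrableOn_Ioi_comp_mul_left_iff (fun s : ℝ => s ^ (k + j) * (1 + s) ^ (-(c + ((k + 1 : ℕ) : ℝ) + 1))) 0 hγ).2 (by simpa using i1)
  have e2 := integral_comp_mul_left_Ioi (fun s : ℝ => s ^ (k + j) * (1 + s) ^ (-(c + ((k + 1 : ℕ) : ℝ) + 1))) 0 hγ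
  refine ⟨IntegrableOn.congr_fun (i2.const_mul K) hEq measurableSet_Ioi, ?_⟩
  rw [← setIntegral_congr_fun measurableSet_Ioi hEq, integral_const_mul, e2, mul_zero, e1, hK]
  have g1 := Gamma_add_nat j ((k + 1 : ℕ) : ℝ) (by positivity)
  rw [show (((k + j : ℕ) : ℝ) + 1) = ((k + 1 : ℕ) : ℝ) + j by push_cast; ring, g1,
    show c + ((k + 1 : ℕ) : ℝ) + 1 - ((k + j : ℕ) : ℝ) - 1 = c + 1 - j by push_cast; ring]
  have h1 := (Real.Gamma_pos_of_pos (show 0 < c + ((k + 1 : ℕ) : ℝ) + 1 by positivity)).ne'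
  have h2 := (Real.Gamma_pos_of_pos (show 0 < ((k + 1 : ℕ) : ℝ) by positivity)).ne'
  have h3 := (Real.Gamma_pos_of_pos (show 0 < c + 1 by positivity)).ne'
  simp only [smul_eq_mul]
  field_simp

noncomputable def rho (n γ : ℝ) : ℕ → Measure ℝ
  | 0 => Measure.dirac 0
  | k + 1 => (volume.restrict (Set.Ioi 0)).withDensity (fun t => ENNReal.ofReal (b n γ (k + 1) t))

noncomputable def nu (n γ x : ℝ) : Measure ℝ :=
  Measure.sum (fun k => ENNReal.ofReal (p n γ k x) • rho n γ k)

lemma b_meas (n γ : ℝ) (k : ℕ) : Measurable (b n γ k) := by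
  unfold b; fun_prop

lemma rho_ae (n γ : ℝ) (k : ℕ) : ∀ᵐ t ∂(rho n γ k), 0 ≤ t := by
  cases k with
  | zero => simp [rho, ae_dirac_eq]
  | succ k =>
    refine (withDensity_absolutelyContinuous _ _).ae_le ?_
    filter_upwards [ae_restrict_mem measurableSet_Ioi] with t ht
    exact le_of_lt ht

lemma nu_ae (n γ x : ℝ) : ∀ᵐ t ∂(nu n γ x), 0 ≤ t := by
  rw [nu, Measure.ae_sum_iff' measurableSet_Ici]
  intro k
  exact Measure.ae_smul_measure (rho_ae n γ k) _

lemma rho_integral {n γ : ℝ} (hn : 0 < n) (hγ : 0 < γ) (k : ℕ) (g : ℝ → ℝ) :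
    ∫ t, g t ∂(rho n γ (k + 1)) = ∫ t in Set.Ioi (0:ℝ), b n γ (k + 1) t * g t := by
  rw [rho, integral_withDensity_eq_integral_toReal_smul (b_meas n γ _).ennreal_ofReal (by simp)]
  refine setIntegral_congr_fun measurableSet_Ioi ?_
  intro t ht
  simp only [smul_eq_mul]
  rw [ENNReal.toReal_ofReal (b_nonneg hn hγ ht k)]

lemma rho_integrable {n γ : ℝ} (hn : 0 < n) (hγ : 0 < γ) (k : ℕ) (g : ℝ → ℝ) :
    Integrable g (rho n γ (k + 1)) ↔ IntegrableOn (fun t => b n γ (k + 1) t * g t) (Set.Ioi 0) := by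
  rw [rho, integrable_withDensity_iff_integrable_smul' (b_meas n γ _).ennreal_ofReal (by simp)]
  refine integrableOn_congr_fun ?_ measurableSet_Ioi
  intro t ht
  simp only [smul_eq_mul]
  rw [ENNReal.toReal_ofReal (b_nonneg hn hγ ht k)]

lemma rho_moment {n γ : ℝ} (hn : 0 < n) (hγ : 0 < γ) (k j : ℕ) (hj : (j : ℝ) < n / γ + 1) :
    Integrable (fun t : ℝ => t ^ j) (rho n γ k) ∧
    ∫ t, t ^ j ∂(rho n γ k) =
      ri j (k : ℝ) * (Real.Gamma (n / γ + 1 - j) / Real.Gamma (n / γ + 1) / γ ^ j) := by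
  cases k with
  | zero =>
    have h3 := (Real.Gamma_pos_of_pos (show 0 < n / γ + 1 by positivity)).ne'
    refine ⟨integrable_dirac (by simp), ?_⟩
    rw [rho, integral_dirac]
    cases j with
    | zero => simp [ri, h3]
    | succ j => simp [ri]
  | succ k =>
    rw [rho_integrable hn hγ, rho_integral hn hγ]
    exact b_moment hn hγ k j hj

lemma p_eq (n γ x : ℝ) (k : ℕ) : p n γ k x = q (n / γ) (γ * x) k := rfl

lemma nu_moment {n γ x : ℝ} (hn : 0 < n) (hγ : 0 < γ) (hx : 0 < x) (j : ℕ) (hj : (j : ℝ) < n / γ + 1) :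
    Integrable (fun t : ℝ => t ^ j) (nu n γ x) ∧
    ∫ t, t ^ j ∂(nu n γ x) =
      F (γ * x) j 0 (n / γ) * Real.Gamma (n / γ + 1 - j) / Real.Gamma (n / γ + 1) / γ ^ j := by
  have hc : 0 < n / γ := by positivity
  have hs := F_sum (mul_pos hγ hx) j 0 (n / γ) hc
  simp only [add_zero] at hs
  have hs2 := hs.mul_right (Real.Gamma (n / γ + 1 - j) / Real.Gamma (n / γ + 1) / γ ^ j)
  have hint : ∀ k, ∫ t, t ^ j ∂(ENNReal.ofReal (p n γ k x) • rho n γ k) =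
      q (n / γ) (γ * x) k * ri j k * (Real.Gamma (n / γ + 1 - j) / Real.Gamma (n / γ + 1) / γ ^ j) := by
    intro k
    rw [integral_smul_measure, (rho_moment hn hγ k j hj).2, p_eq,
      ENNReal.toReal_ofReal (q_nonneg hc (mul_pos hγ hx) k), smul_eq_mul]
    ring
  have hI : Integrable (fun t : ℝ => t ^ j) (nu n γ x) := by
    refine integrable_sum_measure (fun k => (rho_moment hn hγ k j hj).1.smul_measure (by simp)) ?_
    refine hs2.summable.congr ?_
    intro k
    rw [← hint]
    refine integral_congr_ae ?_
    filter_upwards [Measure.ae_smul_measure (rho_ae n γ k) _] with t ht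
    rw [Real.norm_of_nonneg (by positivity)]
  refine ⟨hI, ?_⟩
  rw [nu, integral_sum_measure hI]
  simp only [hint]
  rw [hs2.tsum_eq]
  ring

lemma B_eq {n γ x α β : ℝ} (hn : 0 < n) (hγ : 0 < γ) (hx : 0 < x) (f : ℝ → ℝ)
    (hI : Integrable (fun t => f ((n * t + α) / (n + β))) (nu n γ x)) :
    B n γ α β f x = ∫ t, f ((n * t + α) / (n + β)) ∂(nu n γ x) := by
  have hc : 0 < n / γ := by positivity
  have hsum := hasSum_integral_measure hI
  rw [← nu] at hsum
  have h2 := hsum.summable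
  rw [← hsum.tsum_eq, h2.tsum_eq_zero_add, B, add_comm]
  congr 1
  · rw [integral_smul_measure, p_eq, ENNReal.toReal_ofReal (q_nonneg hc (mul_pos hγ hx) 0), rho, integral_dirac]
    simp
  · congr 1
    ext k
    rw [integral_smul_measure, p_eq, ENNReal.toReal_ofReal (q_nonneg hc (mul_pos hγ hx) _), rho_integral hn hγ]
    simp

lemma poly_asym {γ x : ℝ} (hγ : 0 < γ) (hx : 0 < x) (P : Polynomial ℝ) :
    (∀ᶠ n in atTop, Integrable (fun t => P.eval t) (nu n γ x)) ∧
    E1 (fun n => ∫ t, P.eval t ∂(nu n γ x)) (P.eval x)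
      (x * (1 + γ * x) * P.derivative.derivative.eval x) := by
  induction P using Polynomial.induction_on' with
  | add P Q hP hQ =>
    constructor
    · filter_upwards [hP.1, hQ.1] with n h1 h2
      simp only [Polynomial.eval_add]
      exact h1.add h2
    · have := (hP.2.add hQ.2).congr (B := fun n => ∫ t, (P + Q).eval t ∂(nu n γ x)) ?_
      · simpa [mul_add] using this
      · filter_upwards [hP.1, hQ.1] with n h1 h2
        simp [integral_add h1 h2]
  | monomial j a =>
    have hev : ∀ᶠ n : ℝ in atTop, 0 < n ∧ (j : ℝ) < n / γ + 1 := by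
      filter_upwards [eventually_gt_atTop 0, eventually_gt_atTop (γ * j)] with n h1 h2
      refine ⟨h1, ?_⟩
      have : (j : ℝ) < n / γ := by rw [lt_div_iff₀ hγ]; linarith
      linarith
    constructor
    · filter_upwards [hev] with n hn
      simpa [Polynomial.eval_monomial] using (nu_moment hn.1 hγ hx j hn.2).1.const_mul a
    · have h0 : Tendsto (fun n : ℝ => n / γ) atTop atTop := tendsto_id.atTop_div_const hγ
      have h1 := ((E1_moment (x := x) hγ j).comp h0).const_mul (γ * a)
      have h2 : γ * a * (j * (j - 1) * x ^ (j - 1) * (1 + γ * x) / γ) =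
          x * (1 + γ * x) * (Polynomial.derivative (Polynomial.derivative (Polynomial.monomial j a))).eval x := by
        simp only [Polynomial.derivative_monomial, Polynomial.eval_monomial]
        rcases j with _ | _ | j
        · simp
        · simp
        · simp only [Nat.add_sub_cancel]; push_cast; field_simp; simp; ring
      rw [h2] at h1
      refine h1.congr' ?_
      filter_upwards [hev] with n hn
      simp only [Function.comp, Polynomial.eval_monomial]
      rw [integral_const_mul, (nu_moment hn.1 hγ hx j hn.2).2]
      field_simp

lemma nu_prob {n γ x : ℝ} (hn : 0 < n) (hγ : 0 < γ) (hx : 0 < x) : IsProbabilityMeasure (nu n γ x) := by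
  obtain ⟨h1, h2⟩ := nu_moment hn hγ hx 0 (by simp; positivity)
  have h3 := (Real.Gamma_pos_of_pos (show 0 < n / γ + 1 by positivity)).ne'
  simp only [pow_zero, F] at h1 h2
  have : IsFiniteMeasure (nu n γ x) := by
    rw [integrable_const_iff] at h1; simpa using h1
  constructor
  simp [h3] at h2
  rwa [Measure.real, ENNReal.toReal_eq_one_iff] at h2

lemma taylor_local {f : ℝ → ℝ} {x : ℝ} (hf1 : ∀ᶠ y in nhds x, DifferentiableAt ℝ f y)
    (hf2 : DifferentiableAt ℝ (deriv f) x) {ε : ℝ} (hε : 0 < ε) :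
    ∃ δ > 0, ∀ u, |u - x| < δ →
      |f u - f x - deriv f x * (u - x) - deriv (deriv f) x / 2 * (u - x) ^ 2| ≤ ε * (u - x) ^ 2 := by
  have h := hf2.hasDerivAt.isLittleO.def hε
  obtain ⟨δ, hδ, H⟩ := Metric.eventually_nhds_iff.1 (hf1.and h)
  refine ⟨δ, hδ, fun u hu => ?_⟩
  set φ : ℝ → ℝ := fun u => f u - f x - deriv f x * (u - x) - deriv (deriv f) x / 2 * (u - x) ^ 2 with hφ
  have hd : ∀ v ∈ Metric.closedBall x |u - x|, HasDerivWithinAt φ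
      (deriv f v - deriv f x - deriv (deriv f) x * (v - x)) (Metric.closedBall x |u - x|) v := by
    intro v hv
    have hv' : dist v x < δ := lt_of_le_of_lt hv hu
    have h1 := (H hv').1.hasDerivAt
    have h2 : HasDerivAt (fun v : ℝ => v - x) 1 v := (hasDerivAt_id v).sub_const x
    have h3 := ((h1.sub_const (f x)).sub (h2.const_mul (deriv f x))).sub ((h2.pow 2).const_mul (deriv (deriv f) x / 2))
    refine HasDerivAt.hasDerivWithinAt (h3.congr_deriv ?_)
    simp; ring
  have hb : ∀ v ∈ Metric.closedBall x |u - x|,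
      ‖deriv f v - deriv f x - deriv (deriv f) x * (v - x)‖ ≤ ε * |u - x| := by
    intro v hv
    have hv' : dist v x < δ := lt_of_le_of_lt hv hu
    have h1 : ‖deriv f v - deriv f x - (v - x) • deriv (deriv f) x‖ ≤ ε * ‖v - x‖ := by
      simpa using (H hv').2
    have h2 : ‖v - x‖ ≤ |u - x| := by simpa [Real.dist_eq] using hv
    have h3 : deriv f v - deriv f x - deriv (deriv f) x * (v - x) =
      deriv f v - deriv f x - (v - x) • deriv (deriv f) x := by simp; ring
    rw [h3]
    exact h1.trans (by gcongr)
  have key := (convex_closedBall x |u - x|).norm_image_sub_le_of_norm_hasDerivWithin_le hd hb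
    (Metric.mem_closedBall_self (abs_nonneg _)) (show u ∈ Metric.closedBall x |u - x| by simp [Real.dist_eq])
  have h0 : φ x = 0 := by simp [hφ]
  rw [h0, sub_zero, Real.norm_eq_abs, Real.norm_eq_abs, mul_assoc, ← sq, sq_abs] at key
  exact key

lemma pow_bd {u a : ℝ} {N : ℕ} (hu : 0 ≤ u) (ha : 0 ≤ a) (haN : a ≤ N) : u ^ a ≤ 1 + u ^ N := by
  rcases le_total u 1 with h | h
  · have := Real.rpow_le_one hu h ha
    have : 0 ≤ u ^ N := by positivity
    linarith
  · have := Real.rpow_le_rpow_of_exponent_le h haN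
    rw [Real.rpow_natCast] at this
    linarith

lemma rem_bd {f : ℝ → ℝ} {x M μ : ℝ} {N : ℕ} (hx : 0 < x) (hM : 0 < M) (hμ : 0 < μ)
    (hgrowth : ∀ t : ℝ, 0 ≤ t → |f t| ≤ M * t ^ μ)
    (hN : μ ≤ N) (hN2 : 2 ≤ N)
    (hf1 : ∀ᶠ y in nhds x, DifferentiableAt ℝ f y)
    (hf2 : DifferentiableAt ℝ (deriv f) x) {ε : ℝ} (hε : 0 < ε) :
    ∃ C ≥ 0, ∀ u, 0 ≤ u →
      |f u - f x - deriv f x * (u - x) - deriv (deriv f) x / 2 * (u - x) ^ 2| ≤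
        ε * (u - x) ^ 2 + C * ((u - x) ^ 4 * (1 + u ^ N)) := by
  obtain ⟨δ, hδ, H⟩ := taylor_local hf1 hf2 hε
  set D1 := |deriv f x|
  set D2 := |deriv (deriv f) x / 2|
  set C0 := M + |f x| + D1 * (1 + x) + D2 * (2 + 2 * x ^ 2) with hC0
  have hC0n : 0 ≤ C0 := by positivity
  refine ⟨C0 / δ ^ 4, by positivity, fun u hu => ?_⟩
  rcases lt_or_ge |u - x| δ with h | h
  · have := H u h
    have : 0 ≤ C0 / δ ^ 4 * ((u - x) ^ 4 * (1 + u ^ N)) := by positivity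
    linarith
  · have w1 : 1 ≤ 1 + u ^ N := by have : 0 ≤ u ^ N := by positivity
                                  linarith
    have w2 : u ≤ 1 + u ^ N := by
      simpa using pow_bd (a := 1) (N := N) hu (by norm_num) (by exact_mod_cast (by omega : 1 ≤ N))
    have w3 : u ^ 2 ≤ 1 + u ^ N := by
      have := pow_bd (a := 2) (N := N) hu (by norm_num) (by exact_mod_cast hN2)
      simpa using this
    have w4 := pow_bd (a := μ) (N := N) hu hμ.le hN
    set W := 1 + u ^ N
    have a1 : |f u| ≤ M * W := (hgrowth u hu).trans (by gcongr)
    have a2 : |f x| ≤ |f x| * W := le_mul_of_one_le_right (abs_nonneg _) w1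
    have a3 : |deriv f x * (u - x)| ≤ D1 * ((1 + x) * W) := by
      rw [abs_mul]
      have : |u - x| ≤ (1 + x) * W := by
        rw [abs_le]; constructor <;> nlinarith
      gcongr
    have a4 : |deriv (deriv f) x / 2 * (u - x) ^ 2| ≤ D2 * ((2 + 2 * x ^ 2) * W) := by
      rw [abs_mul, abs_of_nonneg (sq_nonneg (u - x))]
      have : (u - x) ^ 2 ≤ (2 + 2 * x ^ 2) * W := by
        nlinarith [sq_nonneg (u + x), mul_nonneg (sq_nonneg x) (sub_nonneg.2 w1)]
      gcongr
    have a5 : |f u - f x - deriv f x * (u - x) - deriv (deriv f) x / 2 * (u - x) ^ 2| ≤ C0 * W := by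
      refine (abs_sub _ _).trans ?_
      have := abs_sub (f u - f x) (deriv f x * (u - x))
      have := abs_sub (f u) (f x)
      rw [hC0]
      linarith
    have a6 : δ ^ 4 ≤ (u - x) ^ 4 := by
      have h1 : δ ^ 4 ≤ |u - x| ^ 4 := by gcongr
      rwa [show |u - x| ^ 4 = (u - x) ^ 4 from (Even.pow_abs (by decide) _)] at h1
    have a7 : C0 * W ≤ C0 / δ ^ 4 * ((u - x) ^ 4 * W) := by
      rw [div_mul_eq_mul_div, le_div_iff₀ (by positivity)]
      have : 0 ≤ C0 * W := by positivity
      nlinarith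
    have : 0 ≤ ε * (u - x) ^ 2 := by positivity
    linarith

lemma ptwise {α β x n t : ℝ} {N : ℕ} (hα : 0 ≤ α) (hαβ : α ≤ β) (hn : 1 ≤ n) (ht : 0 ≤ t) :
    0 ≤ (n * t + α) / (n + β) ∧
    ((n * t + α) / (n + β) - x) ^ 2 ≤ 2 * (t - x) ^ 2 + 2 * (α - β * x) ^ 2 / n ^ 2 ∧
    ((n * t + α) / (n + β) - x) ^ 4 * (1 + ((n * t + α) / (n + β)) ^ N) ≤
      8 * ((t - x) ^ 4 * (1 + (t + α) ^ N)) + 8 * (α - β * x) ^ 4 / n ^ 4 * (1 + (t + α) ^ N) := by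
  have hβ : 0 ≤ β := hα.trans hαβ
  have hn0 : 0 < n := by linarith
  have hu : 0 ≤ (n * t + α) / (n + β) := by positivity
  have hut : (n * t + α) / (n + β) ≤ t + α := by
    rw [div_le_iff₀ (by linarith)]
    nlinarith [mul_nonneg ht hβ, mul_nonneg hα hβ, mul_nonneg hα (sub_nonneg.2 hn)]
  set s := α - β * x with hs
  have hsq : ((n * t + α) / (n + β) - x) ^ 2 ≤ 2 * (t - x) ^ 2 + 2 * (s / n) ^ 2 := by
    have e : (n * t + α) / (n + β) - x = (n / (n + β)) * ((t - x) + s / n) := by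
      rw [hs]; field_simp; ring
    have h1 : (n / (n + β)) ^ 2 ≤ 1 := by
      apply pow_le_one₀ (by positivity)
      rw [div_le_one (by linarith)]; linarith
    rw [e, mul_pow]
    have h2 : 0 ≤ ((t - x) + s / n) ^ 2 := sq_nonneg _
    nlinarith [sq_nonneg ((t - x) - s / n)]
  have h4 : ((n * t + α) / (n + β) - x) ^ 4 ≤ 8 * (t - x) ^ 4 + 8 * (s / n) ^ 4 := by
    have h5 : 0 ≤ ((n * t + α) / (n + β) - x) ^ 2 := sq_nonneg _
    have h6 := pow_le_pow_left₀ h5 hsq 2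
    nlinarith [sq_nonneg ((t - x) ^ 2 - (s / n) ^ 2)]
  refine ⟨hu, ?_, ?_⟩
  · rw [mul_div_assoc, ← div_pow]; exact hsq
  · have h7 : 1 + ((n * t + α) / (n + β)) ^ N ≤ 1 + (t + α) ^ N := by gcongr
    have h8 := mul_le_mul h4 h7 (by positivity) (by positivity)
    rw [mul_div_assoc, ← div_pow]
    linarith

theorem BDS_voronovskaja (γ α β x : ℝ) (f : ℝ → ℝ) (M μ : ℝ)
    (hx : 0 < x) (hγ : 0 < γ) (hα : 0 ≤ α) (hαβ : α ≤ β) (hM : 0 < M) (hμ : 0 < μ)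
    (hcont : ContinuousOn f (Set.Ici 0))
    (hgrowth : ∀ t : ℝ, 0 ≤ t → |f t| ≤ M * t ^ μ)
    (hf1 : ∀ᶠ y in nhds x, DifferentiableAt ℝ f y)
    (hf2 : DifferentiableAt ℝ (deriv f) x) :
    Tendsto (fun n : ℝ => n * (B n γ α β f x - f x)) atTop
      (nhds ((α - β * x) * deriv f x + x * (1 + γ * x) * deriv (deriv f) x)) := by
  have hβ : 0 ≤ β := hα.trans hαβ
  obtain ⟨N0, hN0⟩ := exists_nat_ge μ
  set N := N0 + 2 with hNdef
  have hN : μ ≤ N := by rw [hNdef]; push_cast; linarith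
  have hN2 : 2 ≤ N := by omega
  set s := α - β * x with hs
  set d1 := deriv f x
  set d2 := deriv (deriv f) x
  let h : ℝ → ℝ → ℝ := fun n t => (n * t + α) / (n + β)
  let R : ℝ → ℝ := fun u => f (max u 0) - f x - d1 * (u - x) - d2 / 2 * (u - x) ^ 2
  have hfc : Continuous (fun u => f (max u 0)) :=
    hcont.comp_continuous (by fun_prop) (fun u => Set.mem_Ici.2 (le_max_right u 0))
  have hRc : Continuous R :=
    ((hfc.sub continuous_const).sub (by fun_prop)).sub (by fun_prop)
  have hhc : ∀ n, Continuous (h n) := fun n => by fun_prop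
  -- polynomials
  let P1 : Polynomial ℝ := Polynomial.X - Polynomial.C x
  let P2 : Polynomial ℝ := (Polynomial.X - Polynomial.C x) ^ 2
  let W : Polynomial ℝ := 1 + (Polynomial.X + Polynomial.C α) ^ N
  let Q : Polynomial ℝ := (Polynomial.X - Polynomial.C x) ^ 4 * W
  have eP1 : ∀ t, P1.eval t = t - x := fun t => by simp [P1]
  have eP2 : ∀ t, P2.eval t = (t - x) ^ 2 := fun t => by simp [P2]
  have eW : ∀ t, W.eval t = 1 + (t + α) ^ N := fun t => by simp [W]
  have eQ : ∀ t, Q.eval t = (t - x) ^ 4 * (1 + (t + α) ^ N) := fun t => by simp [Q, eW]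
  obtain ⟨I1, T1⟩ := poly_asym hγ hx P1
  obtain ⟨I2, T2⟩ := poly_asym hγ hx P2
  obtain ⟨IW, TW⟩ := poly_asym hγ hx W
  obtain ⟨IQ, TQ⟩ := poly_asym hγ hx Q
  have dP1 : (P1.derivative.derivative).eval x = 0 := by simp [P1]
  have dP2 : (P2.derivative.derivative).eval x = 2 := by
    simp [P2, Polynomial.derivative_pow]
  have dQ : (Q.derivative.derivative).eval x = 0 := by
    simp [Q, Polynomial.derivative_pow, Polynomial.derivative_mul]
  have T1' : Tendsto (fun n => n * ∫ t, (t - x) ∂(nu n γ x)) atTop (nhds 0) := by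
    simpa [E1, eP1, dP1] using T1
  have T2' : Tendsto (fun n => n * ∫ t, (t - x) ^ 2 ∂(nu n γ x)) atTop (nhds (x * (1 + γ * x) * 2)) := by
    simpa [E1, eP2, dP2] using T2
  have TQ' : Tendsto (fun n => n * ∫ t, Q.eval t ∂(nu n γ x)) atTop (nhds 0) := by
    have : Q.eval x = 0 := by simp [eQ]
    simpa only [E1, this, dQ, mul_zero, sub_zero] using TQ
  have TW' := TW.tendsto
  simp only [eP1] at I1
  simp only [eP2] at I2
  have bound : ∀ ε > 0, ∃ C ≥ 0, ∀ n, 1 ≤ n → ∀ t, 0 ≤ t → |R (h n t)| ≤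
      ε * (2 * (t - x) ^ 2 + 2 * s ^ 2 / n ^ 2) + C * (8 * Q.eval t + 8 * s ^ 4 / n ^ 4 * W.eval t) := by
    intro ε hε
    obtain ⟨C, hC, H⟩ := rem_bd hx hM hμ hgrowth hN hN2 hf1 hf2 hε
    refine ⟨C, hC, fun n hn t ht => ?_⟩
    obtain ⟨a1, a2, a3⟩ := ptwise (x := x) (N := N) hα hαβ hn ht
    have := H _ a1
    simp only [R, h, max_eq_left a1, eQ, eW]
    refine this.trans ?_
    gcongr
  have bint : ∀ ε C : ℝ, ∀ᶠ n in atTop, Integrable (fun t => ε * (2 * (t - x) ^ 2 + 2 * s ^ 2 / n ^ 2) + C * (8 * Q.eval t + 8 * s ^ 4 / n ^ 4 * W.eval t)) (nu n γ x) := by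
    intro ε C
    filter_upwards [I2, IW, IQ, eventually_gt_atTop 0] with n i2 iW iQ hn
    have := nu_prob hn hγ hx
    exact (((i2.const_mul 2).add (integrable_const _)).const_mul ε).add
      (((iQ.const_mul 8).add (iW.const_mul _)).const_mul C)
  have IR : ∀ᶠ n in atTop, Integrable (fun t => R (h n t)) (nu n γ x) := by
    obtain ⟨C, hC, H⟩ := bound 1 one_pos
    filter_upwards [bint 1 C, eventually_ge_atTop 1] with n hi hn
    refine hi.mono' (hRc.comp (hhc n)).aestronglyMeasurable ?_
    filter_upwards [nu_ae n γ x] with t ht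
    exact H n hn t ht
  have TR : Tendsto (fun n => n * ∫ t, R (h n t) ∂(nu n γ x)) atTop (nhds 0) := by
    rw [Metric.tendsto_nhds]
    intro η hη
    set K := x * (1 + γ * x) * 2 with hK
    have hKpos : 0 < K := by positivity
    set ε := η / (2 * (2 * K + 1)) with hεd
    have hε : 0 < ε := by positivity
    obtain ⟨C, hC, H⟩ := bound ε hε
    have L : Tendsto (fun n : ℝ => ε * (2 * (n * ∫ t, (t - x) ^ 2 ∂(nu n γ x)) + 2 * s ^ 2 * n⁻¹) +
        C * (8 * (n * ∫ t, Q.eval t ∂(nu n γ x)) + 8 * s ^ 4 * (n⁻¹) ^ 3 * ∫ t, W.eval t ∂(nu n γ x))) atTop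
        (nhds (ε * (2 * K + 2 * s ^ 2 * 0) + C * (8 * 0 + 8 * s ^ 4 * 0 ^ 3 * W.eval x))) := by
      have hi : Tendsto (fun n : ℝ => n⁻¹) atTop (nhds 0) := tendsto_inv_atTop_zero
      exact (((T2'.const_mul 2).add (hi.const_mul _)).const_mul ε).add
        (((TQ'.const_mul 8).add (((hi.pow 3).const_mul _).mul TW')).const_mul C)
    have hlt : ε * (2 * K + 2 * s ^ 2 * 0) + C * (8 * 0 + 8 * s ^ 4 * 0 ^ 3 * W.eval x) < η := by
      have : ε * (2 * K + 1) = η / 2 := by rw [hεd]; field_simp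
      have h2 : ε * (2 * K) < ε * (2 * K + 1) := by gcongr; linarith
      simp only [mul_zero, add_zero, zero_mul, ne_eq, OfNat.ofNat_ne_zero, not_false_eq_true, zero_pow]
      linarith
    filter_upwards [L.eventually (gt_mem_nhds hlt), bint ε C, IR, I2, IW, IQ, eventually_ge_atTop 1] with n hL hi iR i2 iW iQ hn
    have hn0 : 0 < n := by linarith
    have := nu_prob hn0 hγ hx
    rw [dist_zero_right, norm_mul, Real.norm_of_nonneg hn0.le]
    have h1 : ‖∫ t, R (h n t) ∂(nu n γ x)‖ ≤ _ := norm_integral_le_of_norm_le hi (by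
      filter_upwards [nu_ae n γ x] with t ht
      exact H n hn t ht)
    refine lt_of_le_of_lt (mul_le_mul_of_nonneg_left h1 hn0.le) (lt_of_eq_of_lt ?_ hL)
    rw [integral_add ?_ ?_, integral_const_mul, integral_const_mul, integral_add ?_ ?_, integral_add ?_ ?_,
      integral_const_mul, integral_const_mul, integral_const_mul]
    · simp
      field_simp
    · exact iQ.const_mul 8
    · exact iW.const_mul _
    · exact i2.const_mul 2
    · exact integrable_const _
    · exact ((i2.const_mul 2).add (integrable_const _)).const_mul ε
    · exact ((iQ.const_mul 8).add (iW.const_mul _)).const_mul C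
  -- final assembly
  have Tf : Tendsto (fun n : ℝ => n / (n + β)) atTop (nhds 1) := by
    have := (E1_frac (-β)).tendsto
    simpa using this
  have Ti : Tendsto (fun n : ℝ => (n + β)⁻¹) atTop (nhds 0) :=
    tendsto_inv_atTop_zero.comp (tendsto_atTop_add_const_right _ β tendsto_id)
  have main : Tendsto (fun n : ℝ => n * (∫ t, R (h n t) ∂(nu n γ x)) +
      d1 * (n / (n + β) * (n * ∫ t, (t - x) ∂(nu n γ x)) + s * (n / (n + β))) +
      d2 / 2 * ((n / (n + β)) ^ 2 * (n * ∫ t, (t - x) ^ 2 ∂(nu n γ x)) +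
        2 * s * (n / (n + β)) * (n + β)⁻¹ * (n * ∫ t, (t - x) ∂(nu n γ x)) +
        s ^ 2 * (n / (n + β)) * (n + β)⁻¹)) atTop
      (nhds (0 + d1 * (1 * 0 + s * 1) + d2 / 2 * (1 ^ 2 * (x * (1 + γ * x) * 2) + 2 * s * 1 * 0 * 0 + s ^ 2 * 1 * 0))) := by
    refine (TR.add (((Tf.mul T1').add (Tf.const_mul s)).const_mul d1)).add (Tendsto.const_mul _ ?_)
    exact (((Tf.pow 2).mul T2').add (((Tf.const_mul _).mul Ti).mul T1')).add ((Tf.const_mul _).mul Ti)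
  have e : (0 + d1 * (1 * 0 + s * 1) + d2 / 2 * (1 ^ 2 * (x * (1 + γ * x) * 2) + 2 * s * 1 * 0 * 0 + s ^ 2 * 1 * 0))
      = s * d1 + x * (1 + γ * x) * d2 := by ring
  rw [e] at main
  refine main.congr' ?_
  filter_upwards [IR, I1, I2, eventually_ge_atTop 1] with n iR i1 i2 hn
  have hn0 : 0 < n := by linarith
  have := nu_prob hn0 hγ hx
  have hnb : n + β ≠ 0 := by linarith
  set A := n / (n + β) with hA
  set E := (n + β)⁻¹ with hE
  let G : ℝ → ℝ := fun t => R (h n t) + (f x + d1 * s * E + d2 / 2 * (s ^ 2 * E ^ 2)) +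
      (d1 * A + d2 / 2 * (2 * A * s * E)) * (t - x) + d2 / 2 * A ^ 2 * (t - x) ^ 2
  have hG : (fun t => f (h n t)) =ᵐ[nu n γ x] G := by
    filter_upwards [nu_ae n γ x] with t ht
    have a1 := (ptwise (x := x) (N := N) hα hαβ hn ht).1
    have e2 : h n t - x = A * (t - x) + s * E := by
      simp only [h, hA, hE, hs]; field_simp; ring
    simp only [G, R, e2]
    rw [max_eq_left a1]
    ring
  have iG : Integrable G (nu n γ x) :=
    ((iR.add (integrable_const _)).add (i1.const_mul _)).add (i2.const_mul _)
  have iF : Integrable (fun t => f (h n t)) (nu n γ x) := iG.congr hG.symm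
  have hB : B n γ α β f x = ∫ t, G t ∂(nu n γ x) := by
    rw [B_eq hn0 hγ hx f iF]; exact integral_congr_ae hG
  have hGi : ∫ t, G t ∂(nu n γ x) = (∫ t, R (h n t) ∂(nu n γ x)) + (f x + d1 * s * E + d2 / 2 * (s ^ 2 * E ^ 2)) +
      (d1 * A + d2 / 2 * (2 * A * s * E)) * (∫ t, (t - x) ∂(nu n γ x)) + d2 / 2 * A ^ 2 * (∫ t, (t - x) ^ 2 ∂(nu n γ x)) := by
    simp only [G]
    rw [integral_add ?_ ?_, integral_add ?_ ?_, integral_add ?_ ?_,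
      integral_const_mul, integral_const_mul]
    · simp
    · exact iR
    · exact integrable_const _
    · exact iR.add (integrable_const _)
    · exact i1.const_mul _
    · exact (iR.add (integrable_const _)).add (i1.const_mul _)
    · exact i2.const_mul _
  rw [hB, hGi, show A = n * E by rw [hA, hE, div_eq_mul_inv]]
  ring
end
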